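/- arXiv:2402.00542 — 3 statements merged into one kernel-verified Lean document; each statement's English description precedes it below -/
import Mathlib

section
/- There is a constant α > 0 such that, when σ is chosen uniformly at random among the permutations of {1,…,n}, the probability that every resolution refutation of rPar(n,σ) has length at least 2^(αn) tends to 1 as n → ∞. -/
abbrev Lit (ν : Type) := ν × Bool
abbrev Clause (ν : Type) := Finset (ν × Bool)
abbrev CNF (ν : Type) := Finset (Finset (ν × Bool))

variable {ν : Type} [DecidableEq ν]

/-- Negation of a literal. -/
def negLit (l : Lit ν) : Lit ν := (l.1, !l.2)

/-- Canonical CNF encoding of the parity constraint `l₁ ⊕ ⋯ ⊕ l_k = c` for the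
literals in the list `ls`: the clauses forbid exactly the assignments under which
the number of true literals among `ls` has parity different from `c`. -/
def parityCNF (ls : List (Lit ν)) (c : Bool) : CNF ν :=
  ((Finset.univ : Finset (Fin ls.length → Bool)).filter
      (fun f => (Finset.univ.filter (fun i => f i = true)).card % 2 = (if c then 0 else 1))).image
    (fun f => Finset.univ.image (fun i => if f i then negLit (ls.get i) else ls.get i))

/-- `xor(l₁,…,l_k)`: canonical CNF encoding of `l₁ ⊕ ⋯ ⊕ l_k = 0`. -/
def xorCNF (ls : List (Lit ν)) : CNF ν := parityCNF ls false

def clauseSat (τ : ν → Bool) (C : Clause ν) : Prop := ∃ l ∈ C, τ l.1 = l.2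

def cnfSat (τ : ν → Bool) (F : CNF ν) : Prop := ∀ C ∈ F, clauseSat τ C

def Unsat (F : CNF ν) : Prop := ¬ ∃ τ : ν → Bool, cnfSat τ F

def cnfVars (F : CNF ν) : Set ν := {v | ∃ C ∈ F, ∃ b, (v, b) ∈ C}

def clauseVars (C : Clause ν) : Set ν := {v | ∃ b, (v, b) ∈ C}

/-- `R` is the resolvent of `C` and `D`. -/
def IsResolvent (C D R : Clause ν) : Prop :=
  ∃ v : ν, (v, true) ∈ C ∧ (v, false) ∈ D ∧ R = C.erase (v, true) ∪ D.erase (v, false)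

/-- A resolution refutation of `F`: a sequence of clauses, each an axiom of `F` or a
resolvent of two earlier clauses, ending with the empty clause. Its length is `L.length`. -/
def IsResRefutation (F : CNF ν) (L : List (Clause ν)) : Prop :=
  L ≠ [] ∧ L.getLast? = some (∅ : Clause ν) ∧
    ∀ i, (hi : i < L.length) →
      L[i] ∈ F ∨ ∃ j k, ∃ (hj : j < i) (hk : k < i),
        IsResolvent (L[j]'(hj.trans hi)) (L[k]'(hk.trans hi)) L[i]

/-- The `j`-th xor constraint (0-based) of `Parity(xs, t)`: for a list `xs` of `n ≥ 4`
literals and Tseitin variables `t 0, …, t (n-4)`, constraint `0` is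
`xor(xs[0], xs[1], t 0)`, constraint `j` for `1 ≤ j ≤ n-4` is
`xor(t (j-1), xs[j+1], t j)`, and constraint `n-3` is `xor(t (n-4), xs[n-2], xs[n-1])`. -/
def parityCtr (xs : List (Lit ν)) (t : ℕ → ν) (j : ℕ) : List (Lit ν) :=
  if j = 0 then [xs.getD 0 (t 0, true), xs.getD 1 (t 0, true), (t 0, true)]
  else if j < xs.length - 3 then [(t (j - 1), true), xs.getD (j + 1) (t 0, true), (t j, true)]
  else [(t (xs.length - 4), true), xs.getD (xs.length - 2) (t 0, true),
    xs.getD (xs.length - 1) (t 0, true)]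

/-- The standard linear CNF encoding `Parity(xs, t)` of the parity constraint
`xs[0] ⊕ ⋯ ⊕ xs[n-1] = 0` using Tseitin variables `t 0, …, t (n-4)`. -/
def ParityCNF (xs : List (Lit ν)) (t : ℕ → ν) : CNF ν :=
  (Finset.range (xs.length - 2)).biUnion (fun j => xorCNF (parityCtr xs t j))

/-- The list of literals `x_0, …, x_{n-1}` (all positive), variable `x_i` encoded as `i : ℕ`. -/
def xListA (n : ℕ) : List (Lit ℕ) := List.ofFn (fun i : Fin n => ((i : ℕ), true))

/-- The list of literals `X'_{σ(0)}, …, X'_{σ(n-1)}` where `X' = (x_0, …, x_{n-2}, ¬x_{n-1})`. -/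
def xListB (n : ℕ) (σ : Equiv.Perm (Fin n)) : List (Lit ℕ) :=
  List.ofFn (fun i : Fin n => (((σ i) : ℕ), decide (((σ i) : ℕ) ≠ n - 1)))

/-- `rPar(n, σ) = Parity(X, S, id) ∧ Parity(X', T, σ)`; the variables `x_i` are encoded
as `i`, the Tseitin variables `S` as `n + k` and `T` as `2n + k`. -/
def rPar (n : ℕ) (σ : Equiv.Perm (Fin n)) : CNF ℕ :=
  ParityCNF (xListA n) (fun k => n + k) ∪ ParityCNF (xListB n σ) (fun k => 2 * n + k)

set_option linter.all false

/-! ### Part 1: size-width tradeoff -/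

inductive Der (F P : Set (Clause ν)) : Clause ν → Prop
  | ax (C : Clause ν) (hF : C ∈ F) (hP : C ∈ P) : Der F P C
  | weak (C D : Clause ν) (h : Der F P C) (hs : C ⊆ D) (hP : D ∈ P) : Der F P D
  | res (l : Lit ν) (C D R : Clause ν) (hC : Der F P C) (hD : Der F P D)
      (hs : C.erase l ∪ D.erase (negLit l) ⊆ R) (hP : R ∈ P) : Der F P R

theorem negLit_negLit (l : Lit ν) : negLit (negLit l) = l := by simp [negLit]

theorem negLit_ne (l : Lit ν) : negLit l ≠ l := by
  intro h
  have := congrArg Prod.snd h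
  simp [negLit] at this

theorem Der.mono {F P Q : Set (Clause ν)} (h : P ⊆ Q) {C : Clause ν} (hd : Der F P C) :
    Der F Q C := by
  induction hd with
  | ax C hF hP => exact .ax C hF (h hP)
  | weak C D _ hs hP ih => exact .weak C D ih hs (h hP)
  | res l C D R _ _ hs hP ih1 ih2 => exact .res l C D R ih1 ih2 hs (h hP)

def restr (x : Lit ν) (P : Set (Clause ν)) : Set (Clause ν) :=
  {C' | ∃ C ∈ P, x ∉ C ∧ C' = C.erase (negLit x)}

theorem Der.restr {F P : Set (Clause ν)} (x : Lit ν) {C : Clause ν} (hd : Der F P C)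
    (hx : x ∉ C) : Der (restr x F) (restr x P) (C.erase (negLit x)) := by
  induction hd with
  | ax C hF hP => exact .ax _ ⟨C, hF, hx, rfl⟩ ⟨C, hP, hx, rfl⟩
  | weak C D _ hs hP ih =>
    exact .weak _ _ (ih (fun h => hx (hs h))) (Finset.erase_subset_erase _ hs) ⟨D, hP, hx, rfl⟩
  | res l C D R _ _ hs hP ih1 ih2 =>
    have hsC : ∀ y, y ∈ C → y ≠ l → y ∈ R := fun y hy hne =>
      hs (Finset.mem_union_left _ (Finset.mem_erase.2 ⟨hne, hy⟩))
    have hsD : ∀ y, y ∈ D → y ≠ negLit l → y ∈ R := fun y hy hne =>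
      hs (Finset.mem_union_right _ (Finset.mem_erase.2 ⟨hne, hy⟩))
    have hR : R.erase (negLit x) ∈ _root_.restr x P := ⟨R, hP, hx, rfl⟩
    by_cases h1 : x = l
    · subst h1
      have hxD : x ∉ D := fun h => hx (hsD x h (negLit_ne x).symm)
      refine .weak _ _ (ih2 hxD) ?_ hR
      intro y hy
      rw [Finset.mem_erase] at hy ⊢
      exact ⟨hy.1, hsD y hy.2 hy.1⟩
    by_cases h2 : x = negLit l
    · have hl : l = negLit x := by rw [h2, negLit_negLit]
      have hxC : x ∉ C := fun h => hx (hsC x h h1)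
      refine .weak _ _ (ih1 hxC) ?_ hR
      intro y hy
      rw [Finset.mem_erase] at hy ⊢
      exact ⟨hy.1, hsC y hy.2 (by rw [hl]; exact hy.1)⟩
    · refine .res l _ _ _ (ih1 fun h => hx (hsC x h h1)) (ih2 fun h => hx (hsD x h h2)) ?_ hR
      intro y hy
      simp only [Finset.mem_union, Finset.mem_erase] at hy ⊢
      rcases hy with ⟨a, b, c⟩ | ⟨a, b, c⟩
      · exact ⟨b, hsC y c a⟩
      · exact ⟨b, hsD y c a⟩

def Wd (w : ℕ) : Set (Clause ν) := {C | C.card ≤ w}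

theorem Der.lift {F : Set (Clause ν)} (x : Lit ν) {w : ℕ} {C : Clause ν}
    (hd : Der (_root_.restr x F) (Wd w) C) : Der F (Wd (w + 1)) (insert (negLit x) C) := by
  have key : ∀ D : Clause ν, D.card ≤ w → insert (negLit x) D ∈ (Wd (w + 1) : Set (Clause ν)) :=
    fun D hD => (Finset.card_insert_le _ _).trans (by omega)
  induction hd with
  | ax C hF hP =>
    obtain ⟨C', hC', hx, rfl⟩ := hF
    have hsub : C' ⊆ insert (negLit x) (C'.erase (negLit x)) := by
      intro y hy
      by_cases h : y = negLit x <;> simp [h, hy]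
    refine .weak C' _ (.ax C' hC' ((Finset.card_le_card hsub).trans (key _ hP))) hsub (key _ hP)
  | weak C D _ hs hP ih => exact .weak _ _ ih (Finset.insert_subset_insert _ hs) (key _ hP)
  | res l C D R _ _ hs hP ih1 ih2 =>
    refine .res l _ _ _ ih1 ih2 ?_ (key _ hP)
    intro y hy
    have := @hs y
    simp only [Finset.mem_union, Finset.mem_erase, Finset.mem_insert] at hy this ⊢
    tauto

theorem Der.unrestr {F : Set (Clause ν)} (x : Lit ν) {w : ℕ} {C : Clause ν}
    (hd : Der (_root_.restr (negLit x) F) (Wd w) C) (hx : Der F (Wd w) {negLit x})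
    (hF : ∀ C ∈ F, C.card ≤ w) : Der F (Wd w) C := by
  induction hd with
  | ax C h hP =>
    obtain ⟨C', hC', _, rfl⟩ := h
    rw [negLit_negLit] at hP ⊢
    refine .res x C' _ _ (.ax C' hC' (hF _ hC')) hx ?_ hP
    simp
  | weak C D _ hs hP ih => exact .weak _ _ ih hs hP
  | res l C D R _ _ hs hP ih1 ih2 => exact .res l _ _ _ ih1 ih2 hs hP

/-- restriction of a finite set of clauses -/
def frestr (x : Lit ν) (P : Finset (Clause ν)) : Finset (Clause ν) :=
  (P.filter (fun C => x ∉ C)).image (fun C => C.erase (negLit x))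

theorem coe_frestr (x : Lit ν) (P : Finset (Clause ν)) :
    (frestr x P : Set (Clause ν)) = restr x (P : Set (Clause ν)) := by
  ext C
  simp only [frestr, restr, Finset.coe_image, Finset.coe_filter, Set.mem_image, Set.mem_ofPred_eq,
    Finset.mem_coe]
  constructor
  · rintro ⟨D, ⟨h1, h2⟩, rfl⟩; exact ⟨D, h1, h2, rfl⟩
  · rintro ⟨D, h1, h2, rfl⟩; exact ⟨D, ⟨h1, h2⟩, rfl⟩

def fat (d : ℕ) (P : Finset (Clause ν)) : Finset (Clause ν) := P.filter (fun C => d ≤ C.card)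

theorem fat_frestr (d : ℕ) (x : Lit ν) (P : Finset (Clause ν)) :
    (fat d (frestr x P)).card + ((fat d P).filter (fun C => x ∈ C)).card ≤ (fat d P).card := by
  rw [← Finset.card_filter_add_card_filter_not (s := fat d P) (fun C => x ∈ C), add_comm]
  refine Nat.add_le_add_left ?_ _
  refine (Finset.card_le_card (t := ((fat d P).filter (fun C => ¬ x ∈ C)).image
    (fun C => C.erase (negLit x))) ?_).trans Finset.card_image_le
  intro C hC
  simp only [fat, frestr, Finset.mem_filter, Finset.mem_image] at hC ⊢
  obtain ⟨⟨D, ⟨h1, h2⟩, rfl⟩, h3⟩ := hC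
  exact ⟨D, ⟨⟨h1, h3.trans (Finset.card_erase_le)⟩, h2⟩, rfl⟩

theorem frestr_sub (x : Lit ν) (P : Finset (Clause ν)) (V : Finset (Lit ν))
    (h : ∀ C ∈ P, C ⊆ V) : ∀ C ∈ frestr x P, C ⊆ (V.erase x).erase (negLit x) := by
  intro C hC y hy
  simp only [frestr, Finset.mem_filter, Finset.mem_image] at hC
  obtain ⟨D, ⟨h1, h2⟩, rfl⟩ := hC
  simp only [Finset.mem_erase] at hy ⊢
  exact ⟨hy.1, fun h => h2 (h ▸ hy.2), h D h1 hy.2⟩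

theorem popular (d M : ℕ) (V : Finset (Lit ν)) (hV : V.card ≤ M) (Q : Finset (Clause ν))
    (hQ : ∀ C ∈ Q, C ⊆ V ∧ d ≤ C.card) (hne : Q.Nonempty) (hd : 0 < d) :
    ∃ x ∈ V, d * Q.card ≤ M * (Q.filter (fun C => x ∈ C)).card := by
  by_contra hcon
  push Not at hcon
  have hVne : V.Nonempty := by
    obtain ⟨C, hC⟩ := hne
    have h1 := Finset.card_le_card (hQ C hC).1
    have h2 := (hQ C hC).2
    exact Finset.card_pos.1 (by omega)
  have h1 : ∑ x ∈ V, (Q.filter (fun C => x ∈ C)).card = ∑ C ∈ Q, C.card := by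
    simp only [Finset.card_filter]
    rw [Finset.sum_comm]
    refine Finset.sum_congr rfl fun C hC => ?_
    rw [← Finset.card_filter]
    congr 1
    ext y
    simp only [Finset.mem_filter]
    exact ⟨fun h => h.2, fun h => ⟨(hQ C hC).1 h, h⟩⟩
  have h2 : d * Q.card ≤ ∑ C ∈ Q, C.card := by
    have := Finset.card_nsmul_le_sum Q (fun C => C.card) d (fun C hC => (hQ C hC).2)
    simpa [mul_comm] using this
  have h3 : ∑ x ∈ V, M * (Q.filter (fun C => x ∈ C)).card < ∑ x ∈ V, d * Q.card :=
    Finset.sum_lt_sum_of_nonempty hVne hcon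
  rw [← Finset.mul_sum, h1, Finset.sum_const, smul_eq_mul] at h3
  have h4 : V.card * (d * Q.card) ≤ M * (d * Q.card) := Nat.mul_le_mul_right _ hV
  have h5 : M * (d * Q.card) ≤ M * ∑ C ∈ Q, C.card := Nat.mul_le_mul_left _ h2
  omega

theorem size_width (d M w0 : ℕ) (hd : 0 < d) (hdM : d ≤ M) :
    ∀ (m b : ℕ) (F : Set (Clause ν)) (P : Finset (Clause ν)) (V : Finset (Lit ν)),
      V.card ≤ m → V.card ≤ M → (∀ C ∈ P, C ⊆ V) → (∀ C ∈ F, C.card ≤ w0) →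
      Der F (P : Set (Clause ν)) ∅ →
      ((fat d P).card : ℝ) * (1 - d / M : ℝ) ^ b < 1 → Der F (Wd (d + b + w0)) ∅ := by
  have hM : 0 < M := by omega
  have hM' : (0 : ℝ) < M := by exact_mod_cast hM
  have hq0 : (0 : ℝ) ≤ 1 - d / M := by
    rw [sub_nonneg, div_le_one hM']; exact_mod_cast hdM
  intro m
  induction m with
  | zero =>
    intro b F P V hV _ hP _ hder _
    refine hder.mono ?_
    intro C hC
    have := Finset.card_le_card (hP C hC)
    show C.card ≤ _
    omega
  | succ m ih =>
    intro b F P V hV hVM hP hF hder hfat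
    rcases Finset.eq_empty_or_nonempty (fat d P) with he | hne
    · refine hder.mono ?_
      intro C hC
      by_contra hcon
      have : C ∈ fat d P := Finset.mem_filter.2 ⟨hC, by
        have : ¬ C.card ≤ _ := hcon
        omega⟩
      rw [he] at this
      simp at this
    obtain ⟨x, hxV, hx⟩ := popular d M V hVM (fat d P)
      (fun C hC => ⟨hP C (Finset.mem_filter.1 hC).1, (Finset.mem_filter.1 hC).2⟩) hne hd
    have hcard : ∀ y ∈ ({x, negLit x} : Finset (Lit ν)),
        ((V.erase y).erase (negLit y)).card ≤ m ∧ ((V.erase y).erase (negLit y)).card ≤ M := by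
      intro y hy
      have h1 : (V.erase x).card < V.card := Finset.card_erase_lt_of_mem hxV
      have h2 : ((V.erase y).erase (negLit y)).card ≤ (V.erase x).card := by
        apply Finset.card_le_card
        simp only [Finset.mem_insert, Finset.mem_singleton] at hy
        rcases hy with rfl | rfl
        · exact Finset.erase_subset _ _
        · rw [negLit_negLit]
          exact Finset.erase_subset_erase _ (Finset.erase_subset _ _)
      omega
    have hFr : ∀ y, ∀ C ∈ restr y F, C.card ≤ w0 := by
      rintro y C ⟨D, hD, _, rfl⟩
      exact Finset.card_erase_le.trans (hF D hD)
    have hderr : ∀ y, Der (restr y F) (frestr y P : Set (Clause ν)) ∅ := by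
      intro y
      have := hder.restr y (by simp)
      rw [coe_frestr]
      simpa using this
    have hneg := hcard (negLit x) (by simp)
    have hpos := hcard x (by simp)
    have hf1 : ((fat d (frestr x P)).card : ℝ) ≤ (fat d P).card * (1 - d / M : ℝ) := by
      have h1 := fat_frestr d x P
      have h1' : ((fat d (frestr x P)).card : ℝ) + ((fat d P).filter (fun C => x ∈ C)).card
        ≤ (fat d P).card := by exact_mod_cast h1
      have h2' : (d : ℝ) * (fat d P).card ≤ M * ((fat d P).filter (fun C => x ∈ C)).card := by
        exact_mod_cast hx
      have h3 : (d : ℝ) / M * (fat d P).card ≤ ((fat d P).filter (fun C => x ∈ C)).card := by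
        rw [div_mul_eq_mul_div, div_le_iff₀ hM']
        linarith
      linarith
    cases b with
    | zero =>
      have : 1 ≤ (fat d P).card := Finset.card_pos.2 hne
      have : (1 : ℝ) ≤ (fat d P).card := by exact_mod_cast this
      rw [pow_zero, mul_one] at hfat
      linarith
    | succ b =>
      have hA := ih b (restr x F) (frestr x P) _ hpos.1 hpos.2 (frestr_sub x P V hP) (hFr x)
        (hderr x) (by
          refine lt_of_le_of_lt ?_ hfat
          rw [pow_succ', ← mul_assoc]
          gcongr)
      have hB := ih (b + 1) (restr (negLit x) F) (frestr (negLit x) P) _ hneg.1 hneg.2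
        (frestr_sub _ P V hP) (hFr _) (hderr _) (by
          refine lt_of_le_of_lt (mul_le_mul_of_nonneg_right ?_ (pow_nonneg hq0 _)) hfat
          have := fat_frestr d (negLit x) P
          exact_mod_cast (by omega : (fat d (frestr (negLit x) P)).card ≤ (fat d P).card))
      have hA' := hA.lift
      have e : d + b + w0 + 1 = d + (b + 1) + w0 := by omega
      rw [e] at hA'
      refine Der.unrestr x hB (by simpa using hA') ?_
      intro C hC
      have := hF C hC
      omega

theorem der_of_refutation {F : CNF ν} {L : List (Clause ν)} (h : IsResRefutation F L) :
    Der (F : Set (Clause ν)) (L.toFinset : Set (Clause ν)) ∅ := by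
  obtain ⟨hne, hlast, hstep⟩ := h
  have key : ∀ i, (hi : i < L.length) → Der (F : Set (Clause ν)) (L.toFinset : Set (Clause ν)) L[i] := by
    intro i
    induction i using Nat.strong_induction_on with
    | _ i ih =>
      intro hi
      have hmem : L[i] ∈ (L.toFinset : Set (Clause ν)) := by simp
      rcases hstep i hi with h | ⟨j, k, hj, hk, v, hv1, hv2, hR⟩
      · exact .ax _ h hmem
      · refine .res (v, true) _ _ _ (ih j hj (hj.trans hi)) (ih k hk (hk.trans hi)) ?_ hmem
        rw [hR]
        rfl
  rw [List.getLast?_eq_getElem?] at hlast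
  obtain ⟨hi, he⟩ := List.getElem?_eq_some_iff.1 hlast
  rw [← he]
  exact key _ hi

theorem vars_of_refutation {F : CNF ν} {L : List (Clause ν)} (h : IsResRefutation F L)
    (V : Finset (Lit ν)) (hV : ∀ C ∈ F, C ⊆ V) : ∀ C ∈ L.toFinset, C ⊆ V := by
  obtain ⟨hne, hlast, hstep⟩ := h
  have key : ∀ i, (hi : i < L.length) → L[i] ⊆ V := by
    intro i
    induction i using Nat.strong_induction_on with
    | _ i ih =>
      intro hi
      rcases hstep i hi with h | ⟨j, k, hj, hk, v, hv1, hv2, hR⟩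
      · exact hV _ h
      · rw [hR]
        exact Finset.union_subset ((Finset.erase_subset _ _).trans (ih j hj _))
          ((Finset.erase_subset _ _).trans (ih k hk _))
  intro C hC
  obtain ⟨i, hi, rfl⟩ := List.getElem_of_mem (List.mem_toFinset.1 hC)
  exact key i hi

theorem refutation_width (d b M w0 : ℕ) (hd : 0 < d) (hdM : d ≤ M) {F : CNF ν}
    {L : List (Clause ν)} (h : IsResRefutation F L) (V : Finset (Lit ν)) (hVM : V.card ≤ M)
    (hV : ∀ C ∈ F, C ⊆ V) (hw : ∀ C ∈ F, C.card ≤ w0)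
    (hL : (L.length : ℝ) * (1 - d / M : ℝ) ^ b < 1) :
    Der (F : Set (Clause ν)) (Wd (d + b + w0)) ∅ := by
  refine size_width d M w0 hd hdM _ b F L.toFinset V le_rfl hVM (vars_of_refutation h V hV)
    (fun C hC => hw C hC) (der_of_refutation h) (lt_of_le_of_lt ?_ hL)
  have hM' : (0 : ℝ) < M := by exact_mod_cast (by omega : 0 < M)
  have hq0 : (0 : ℝ) ≤ 1 - d / M := by
    rw [sub_nonneg, div_le_one hM']; exact_mod_cast hdM
  gcongr
  exact (Finset.card_filter_le _ _).trans (List.toFinset_card_le L)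

/-! ### Part 2: width lower bound from expansion -/

def litPar (ls : List (Lit ν)) (τ : ν → Bool) : Bool :=
  ls.foldr (fun l acc => xor (decide (τ l.1 = l.2)) acc) false

theorem litPar_sum (τ : ν → Bool) (ls : List (Lit ν)) :
    (∑ i : Fin ls.length, if τ (ls.get i).1 = (ls.get i).2 then 1 else 0) % 2 =
      if litPar ls τ then 1 else 0 := by
  induction ls with
  | nil => simp [litPar]
  | cons l ls ih =>
    have e : litPar (l :: ls) τ = xor (decide (τ l.1 = l.2)) (litPar ls τ) := rfl
    have h2 : (∑ i : Fin (l :: ls).length,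
        if τ ((l :: ls).get i).1 = ((l :: ls).get i).2 then 1 else 0) =
        (if τ l.1 = l.2 then 1 else 0) +
          ∑ i : Fin ls.length, if τ (ls.get i).1 = (ls.get i).2 then 1 else 0 := by
      exact Fin.sum_univ_succ (n := ls.length) _
    rw [h2, Nat.add_mod, ih, e]
    by_cases h : τ l.1 = l.2 <;> cases litPar ls τ <;> simp [h]

theorem xorCNF_sound (ls : List (Lit ν)) (τ : ν → Bool) (h : litPar ls τ = false)
    (C : Clause ν) (hC : C ∈ xorCNF ls) : clauseSat τ C := by
  simp only [xorCNF, parityCNF, Finset.mem_image, Finset.mem_filter, Finset.mem_univ,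
    true_and] at hC
  obtain ⟨f, hf, rfl⟩ := hC
  by_contra hcon
  have key : ∀ i, f i = true ↔ τ (ls.get i).1 = (ls.get i).2 := by
    intro i
    have h1 : ¬ τ (if f i then negLit (ls.get i) else ls.get i).1 =
        (if f i then negLit (ls.get i) else ls.get i).2 := by
      intro h2
      exact hcon ⟨_, Finset.mem_image_of_mem _ (Finset.mem_univ i), h2⟩
    cases hfi : f i
    · simpa [hfi] using h1
    · simp only [hfi, if_true, negLit] at h1
      simpa using h1
  have h3 := litPar_sum τ ls
  rw [← Finset.card_filter] at h3
  simp only [key] at hf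
  rw [h3, h] at hf
  simp at hf

theorem litPar_flip (ls : List (Lit ν)) (τ : ν → Bool) (v : ν) :
    litPar ls (Function.update τ v (!τ v)) =
      xor (litPar ls τ) (decide ((ls.map Prod.fst).count v % 2 = 1)) := by
  induction ls with
  | nil => simp [litPar]
  | cons l ls ih =>
    have e : ∀ τ, litPar (l :: ls) τ = xor (decide (τ l.1 = l.2)) (litPar ls τ) := fun _ => rfl
    rw [e, e, ih]
    obtain ⟨u, β⟩ := l
    rw [List.map_cons, List.count_cons]
    have hm := Nat.mod_two_eq_zero_or_one ((ls.map Prod.fst).count v)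
    by_cases h : u = v
    · subst h
      rcases hm with hm | hm
      · have : (List.count u (List.map Prod.fst ls) + 1) % 2 = 1 := by omega
        simp only [Function.update_self, BEq.rfl, if_true, this, hm]
        cases τ u <;> cases β <;> cases litPar ls τ <;> simp
      · have : (List.count u (List.map Prod.fst ls) + 1) % 2 = 0 := by omega
        simp only [Function.update_self, BEq.rfl, if_true, this, hm]
        cases τ u <;> cases β <;> cases litPar ls τ <;> simp
    · have h' : (u == v) = false := by simpa using h
      simp only [Function.update_of_ne h, h', Bool.xor_assoc]
      simp

def Impl {ι : Type} (con : ι → List (Lit ν)) (S : Finset ι) (C : Clause ν) : Prop :=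
  ∀ τ, (∀ c ∈ S, litPar (con c) τ = false) → clauseSat τ C

def IsBd {ι : Type} (con : ι → List (Lit ν)) (S : Finset ι) (v : ν) : Prop :=
  ∃ c ∈ S, ((con c).map Prod.fst).count v = 1 ∧
    ∀ c' ∈ S, c' ≠ c → ((con c').map Prod.fst).count v = 0

theorem exists_minimal_impl {ι : Type} [DecidableEq ι] (con : ι → List (Lit ν)) (S : Finset ι)
    (C : Clause ν) (h : Impl con S C) :
    ∃ S' ⊆ S, Impl con S' C ∧ ∀ v, IsBd con S' v → v ∈ C.image Prod.fst := by
  classical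
  obtain ⟨S', hS', hmin⟩ := Finset.exists_min_image (S.powerset.filter (fun T => Impl con T C))
    Finset.card ⟨S, by simp [h]⟩
  simp only [Finset.mem_filter, Finset.mem_powerset] at hS' hmin
  refine ⟨S', hS'.1, hS'.2, ?_⟩
  rintro v ⟨c, hc, hcv, hoth⟩
  have hnot : ¬ Impl con (S'.erase c) C := by
    intro hI
    have := hmin _ ⟨(Finset.erase_subset _ _).trans hS'.1, hI⟩
    have := Finset.card_erase_lt_of_mem hc
    omega
  simp only [Impl] at hnot
  push Not at hnot
  obtain ⟨τ, hτ, hτC⟩ := hnot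
  have hcf : litPar (con c) τ = true := by
    by_contra hf
    apply hτC
    apply hS'.2
    intro c' hc'
    by_cases e : c' = c
    · subst e; simpa using hf
    · exact hτ c' (Finset.mem_erase.2 ⟨e, hc'⟩)
  have hsat : clauseSat (Function.update τ v (!τ v)) C := by
    apply hS'.2
    intro c' hc'
    rw [litPar_flip]
    by_cases e : c' = c
    · subst e; simp [hcf, hcv]
    · simp [hoth c' hc' e, hτ c' (Finset.mem_erase.2 ⟨e, hc'⟩)]
  obtain ⟨l, hl, hl2⟩ := hsat
  by_cases e : l.1 = v
  · exact Finset.mem_image.2 ⟨l, hl, e⟩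
  · rw [Function.update_of_ne e] at hl2
    exact absurd ⟨l, hl, hl2⟩ hτC

theorem width_lb {ι : Type} [DecidableEq ι] (con : ι → List (Lit ν)) (F : Set (Clause ν))
    (I : Finset ι) (r w : ℕ) (hr : 1 ≤ r)
    (hF : ∀ C ∈ F, ∃ c ∈ I, ∀ τ, litPar (con c) τ = false → clauseSat τ C)
    (hexp : ∀ S ⊆ I, r < S.card → S.card ≤ 2 * r → ∀ B : Finset ν,
      (∀ v, IsBd con S v → v ∈ B) → w < B.card)
    (hconn : ∀ S ⊆ I, S.Nonempty → S.card ≤ r → ∃ v, IsBd con S v) :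
    ¬ Der F (Wd w) ∅ := by
  have key : ∀ C, Der F (Wd w) C → ∃ S ⊆ I, S.card ≤ r ∧ Impl con S C := by
    intro C hC
    induction hC with
    | ax C h hP =>
      obtain ⟨c, hc, hs⟩ := hF C h
      exact ⟨{c}, by simpa using hc, by simpa using hr, fun τ hτ => hs τ (hτ c (by simp))⟩
    | weak C D _ hs hP ih =>
      obtain ⟨S, h1, h2, h3⟩ := ih
      refine ⟨S, h1, h2, fun τ hτ => ?_⟩
      obtain ⟨l, hl, hl2⟩ := h3 τ hτ
      exact ⟨l, hs hl, hl2⟩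
    | res l C D R _ _ hs hP ih1 ih2 =>
      obtain ⟨S, h1, h2, h3⟩ := ih1
      obtain ⟨T, k1, k2, k3⟩ := ih2
      have hI : Impl con (S ∪ T) R := by
        intro τ hτ
        obtain ⟨a, ha, ha2⟩ := h3 τ (fun c hc => hτ c (Finset.mem_union_left _ hc))
        obtain ⟨b, hb, hb2⟩ := k3 τ (fun c hc => hτ c (Finset.mem_union_right _ hc))
        by_cases e : a = l
        · have e2 : b ≠ negLit l := by
            rintro rfl
            subst e
            simp [negLit, ha2] at hb2
          exact ⟨b, hs (Finset.mem_union_right _ (Finset.mem_erase.2 ⟨e2, hb⟩)), hb2⟩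
        · exact ⟨a, hs (Finset.mem_union_left _ (Finset.mem_erase.2 ⟨e, ha⟩)), ha2⟩
      obtain ⟨S', hS', hI', hbd⟩ := exists_minimal_impl con _ R hI
      have hsub : S' ⊆ I := hS'.trans (Finset.union_subset h1 k1)
      refine ⟨S', hsub, ?_, hI'⟩
      by_contra hlt
      have hc1 := Finset.card_le_card hS'
      have hc2 := Finset.card_union_le S T
      have := hexp S' hsub (by omega) (by omega) _ hbd
      have h4 : (R.image Prod.fst).card ≤ R.card := Finset.card_image_le
      have h5 : R.card ≤ w := hP
      omega
  intro h
  obtain ⟨S, h1, h2, h3⟩ := key _ h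
  obtain ⟨S', hS', hI', hbd⟩ := exists_minimal_impl con _ _ h3
  rcases Finset.eq_empty_or_nonempty S' with rfl | hne
  · obtain ⟨l, hl, _⟩ := hI' (fun _ => true) (by simp)
    simp at hl
  · obtain ⟨v, hv⟩ := hconn S' (hS'.trans h1) hne ((Finset.card_le_card hS').trans h2)
    have := hbd v hv
    simp at this

/-! ### Part 3: the structure of `rPar` -/

def posn (n i : ℕ) : ℕ := min (i - 1) (n - 3)

def varList (n : ℕ) (p t : ℕ → ℕ) (j : ℕ) : List ℕ :=
  if j = 0 then [p 0, p 1, t 0] else if j < n - 3 then [t (j - 1), p (j + 1), t j]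
  else [t (n - 4), p (n - 2), p (n - 1)]

theorem parityCtr_vars (n : ℕ) (hn : 4 ≤ n) (xs : List (Lit ℕ)) (hxs : xs.length = n)
    (p t : ℕ → ℕ) (hp : ∀ i < n, ∀ d, (xs.getD i d).1 = p i) (j : ℕ) :
    (parityCtr xs t j).map Prod.fst = varList n p t j := by
  unfold parityCtr varList
  rw [hxs]
  split_ifs
  · simp only [List.map_cons, List.map_nil, hp 0 (by omega), hp 1 (by omega)]
  · simp only [List.map_cons, List.map_nil, hp (j + 1) (by omega)]
  · simp only [List.map_cons, List.map_nil, hp (n - 2) (by omega), hp (n - 1) (by omega)]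

theorem count_three (a b c v : ℕ) : [a, b, c].count v =
    (if a = v then 1 else 0) + (if b = v then 1 else 0) + (if c = v then 1 else 0) := by
  simp only [List.count_cons, List.count_nil, beq_iff_eq]
  omega

theorem count_path (n : ℕ) (hn : 4 ≤ n) (p : ℕ → ℕ) (T : ℕ) (hT : n ≤ T) (hp : ∀ i, p i < n)
    (j : ℕ) (hj : j < n - 2) (k : ℕ) (hk : k < n - 3) :
    (varList n p (fun k => T + k) j).count (T + k) = if j = k ∨ j = k + 1 then 1 else 0 := by
  have h : ∀ i, p i ≠ T + k := fun i => by have := hp i; omega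
  unfold varList
  split_ifs <;> rw [count_three] <;> simp only [h, if_false] <;> split_ifs <;> omega

theorem count_other (n : ℕ) (hn : 4 ≤ n) (p : ℕ → ℕ) (T : ℕ) (hp : ∀ i, p i < n)
    (j : ℕ) (hj : j < n - 2) (v : ℕ) (hv : n ≤ v) (hv2 : v < T ∨ T + (n - 3) ≤ v) :
    (varList n p (fun k => T + k) j).count v = 0 := by
  have h : ∀ i, p i ≠ v := fun i => by have := hp i; omega
  unfold varList
  split_ifs <;> rw [count_three] <;> simp only [h, if_false] <;> split_ifs <;> omega

theorem count_x (n : ℕ) (hn : 4 ≤ n) (p : ℕ → ℕ) (T : ℕ) (hT : n ≤ T) (hp : ∀ i, p i < n)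
    (hinj : ∀ i < n, ∀ i' < n, p i = p i' → i = i')
    (j : ℕ) (hj : j < n - 2) (i : ℕ) (hi : i < n) :
    (varList n p (fun k => T + k) j).count (p i) = if j = posn n i then 1 else 0 := by
  have h : ∀ k, T + k ≠ p i := fun k => by have := hp i; omega
  have h2 : ∀ i' < n, (p i' = p i ↔ i' = i) := fun i' hi' =>
    ⟨fun e => hinj i' hi' i hi e, fun e => by rw [e]⟩
  unfold varList posn
  split_ifs <;> rw [count_three] <;> simp only [h, if_false]
  all_goals first
    | simp only [h2 0 (by omega), h2 1 (by omega)]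
    | simp only [h2 (j + 1) (by omega)]
    | simp only [h2 (n - 2) (by omega), h2 (n - 1) (by omega)]
  all_goals split_ifs <;> omega

def pB (n : ℕ) (σ : Equiv.Perm (Fin n)) (i : ℕ) : ℕ := if h : i < n then (σ ⟨i, h⟩ : ℕ) else 0
def pA (n : ℕ) (i : ℕ) : ℕ := if i < n then i else 0

def conr (n : ℕ) (σ : Equiv.Perm (Fin n)) : Bool × ℕ → List (Lit ℕ)
  | (true, j) => parityCtr (xListA n) (fun k => n + k) j
  | (false, j) => parityCtr (xListB n σ) (fun k => 2 * n + k) j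

def pp (n : ℕ) (σ : Equiv.Perm (Fin n)) : Bool → ℕ → ℕ
  | true => pA n
  | false => pB n σ

def TT (n : ℕ) : Bool → ℕ
  | true => n
  | false => 2 * n

theorem pp_lt (n : ℕ) (hn : 4 ≤ n) (σ : Equiv.Perm (Fin n)) (s : Bool) (i : ℕ) :
    pp n σ s i < n := by
  cases s
  · show pB n σ i < n
    unfold pB
    split_ifs
    · exact (σ _).2
    · omega
  · show pA n i < n
    unfold pA
    split_ifs <;> omega

theorem pp_inj (n : ℕ) (σ : Equiv.Perm (Fin n)) (s : Bool) :
    ∀ i < n, ∀ i' < n, pp n σ s i = pp n σ s i' → i = i' := by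
  intro i hi i' hi' h
  cases s
  · have h' : pB n σ i = pB n σ i' := h
    unfold pB at h'
    rw [dif_pos hi, dif_pos hi'] at h'
    have := σ.injective (Fin.ext h')
    simpa using this
  · have h' : pA n i = pA n i' := h
    unfold pA at h'
    rwa [if_pos hi, if_pos hi'] at h'

theorem conr_vars (n : ℕ) (hn : 4 ≤ n) (σ : Equiv.Perm (Fin n)) (s : Bool) (j : ℕ) :
    (conr n σ (s, j)).map Prod.fst = varList n (pp n σ s) (fun k => TT n s + k) j := by
  cases s
  · refine parityCtr_vars n hn _ (by simp [xListB]) (pB n σ) _ ?_ j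
    intro i hi d
    rw [List.getD_eq_getElem _ _ (by simpa [xListB] using hi)]
    simp [xListB, pB, hi]
  · refine parityCtr_vars n hn _ (by simp [xListA]) (pA n) _ ?_ j
    intro i hi d
    rw [List.getD_eq_getElem _ _ (by simpa [xListA] using hi)]
    simp [xListA, pA, hi]

theorem le_TT (n : ℕ) (s : Bool) : n ≤ TT n s := by cases s <;> simp only [TT] <;> omega

theorem conr_count_path (n : ℕ) (hn : 4 ≤ n) (σ : Equiv.Perm (Fin n)) (s s' : Bool) (j k : ℕ)
    (hj : j < n - 2) (hk : k < n - 3) :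
    ((conr n σ (s', j)).map Prod.fst).count (TT n s + k) =
      if s' = s ∧ (j = k ∨ j = k + 1) then 1 else 0 := by
  rw [conr_vars n hn]
  by_cases h : s' = s
  · subst h
    rw [count_path n hn _ _ (le_TT n s') (pp_lt n hn σ s') j hj k hk]
    simp
  · rw [count_other n hn _ _ (pp_lt n hn σ s') j hj]
    · simp [h]
    · have := le_TT n s; omega
    · cases s <;> cases s' <;> simp [TT] at * <;> omega

theorem conr_count_x (n : ℕ) (hn : 4 ≤ n) (σ : Equiv.Perm (Fin n)) (s : Bool) (j : ℕ) (i : Fin n)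
    (hj : j < n - 2) :
    ((conr n σ (s, j)).map Prod.fst).count (σ i : ℕ) =
      if (s = true ∧ j = posn n (σ i)) ∨ (s = false ∧ j = posn n i) then 1 else 0 := by
  rw [conr_vars n hn]
  cases s
  · have e : (σ i : ℕ) = pp n σ false i := by
      show _ = pB n σ i
      simp [pB]
    rw [e, count_x n hn _ _ (le_TT n _) (pp_lt n hn σ _) (pp_inj n σ _) j hj i i.2]
    simp
  · have e : (σ i : ℕ) = pp n σ true (σ i) := by
      show _ = pA n (σ i)
      simp [pA]
    conv_lhs => rw [e]
    rw [count_x n hn _ _ (le_TT n _) (pp_lt n hn σ _) (pp_inj n σ _) j hj (σ i) (σ i).2]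
    simp

def Idx (n : ℕ) : Finset (Bool × ℕ) := Finset.univ ×ˢ Finset.range (n - 2)

theorem isBd_of (n : ℕ) (σ : Equiv.Perm (Fin n)) (S : Finset (Bool × ℕ)) (hS : S ⊆ Idx n)
    (v : ℕ) (a b : Bool × ℕ)
    (hv : ∀ c ∈ Idx n, ((conr n σ c).map Prod.fst).count v = if c = a ∨ c = b then 1 else 0)
    (h : ¬ (a ∈ S ↔ b ∈ S)) : IsBd (conr n σ) S v := by
  have main : ∀ a b : Bool × ℕ, (∀ c ∈ Idx n, ((conr n σ c).map Prod.fst).count v =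
      if c = a ∨ c = b then 1 else 0) → a ∈ S → b ∉ S → IsBd (conr n σ) S v := by
    intro a b hv ha hb
    refine ⟨a, ha, by rw [hv a (hS ha)]; simp, ?_⟩
    intro c hc hne
    have : c ≠ b := by rintro rfl; exact hb hc
    rw [hv c (hS hc)]
    simp [hne, this]
  by_cases ha : a ∈ S
  · exact main a b hv ha (by tauto)
  · exact main b a (fun c hc => by rw [hv c hc]; simp only [or_comm]) (by tauto) ha

theorem bd_path (n : ℕ) (hn : 4 ≤ n) (σ : Equiv.Perm (Fin n)) (S : Finset (Bool × ℕ))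
    (hS : S ⊆ Idx n) (s : Bool) (k : ℕ) (hk : k < n - 3)
    (h : ¬ ((s, k) ∈ S ↔ (s, k + 1) ∈ S)) : IsBd (conr n σ) S (TT n s + k) := by
  refine isBd_of n σ S hS _ _ _ ?_ h
  rintro ⟨s', j⟩ hc
  simp only [Idx, Finset.mem_product, Finset.mem_univ, true_and, Finset.mem_range] at hc
  rw [conr_count_path n hn σ s s' j k hc hk]
  simp only [Prod.mk.injEq]
  congr 1
  apply propext
  tauto

theorem bd_x (n : ℕ) (hn : 4 ≤ n) (σ : Equiv.Perm (Fin n)) (S : Finset (Bool × ℕ))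
    (hS : S ⊆ Idx n) (i : Fin n)
    (h : ¬ ((true, posn n (σ i)) ∈ S ↔ (false, posn n i) ∈ S)) :
    IsBd (conr n σ) S (σ i : ℕ) := by
  refine isBd_of n σ S hS _ _ _ ?_ h
  rintro ⟨s', j⟩ hc
  simp only [Idx, Finset.mem_product, Finset.mem_univ, true_and, Finset.mem_range] at hc
  rw [conr_count_x n hn σ s' j i hc]
  simp only [Prod.mk.injEq]

theorem conn (n : ℕ) (hn : 4 ≤ n) (σ : Equiv.Perm (Fin n)) (S : Finset (Bool × ℕ))
    (hS : S ⊆ Idx n) (hne : S.Nonempty) (hc : S.card < n - 2) : ∃ v, IsBd (conr n σ) S v := by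
  by_contra hcon
  push Not at hcon
  obtain ⟨⟨s, j⟩, hj⟩ := hne
  have hj' := hS hj
  simp only [Idx, Finset.mem_product, Finset.mem_univ, true_and, Finset.mem_range] at hj'
  have hstep : ∀ k < n - 3, ((s, k) ∈ S ↔ (s, k + 1) ∈ S) := by
    intro k hk
    by_contra h
    exact hcon _ (bd_path n hn σ S hS s k hk h)
  have hall : ∀ k, k < n - 2 → ((s, k) ∈ S ↔ (s, 0) ∈ S) := by
    intro k
    induction k with
    | zero => simp
    | succ k ih =>
      intro hk
      rw [← hstep k (by omega)]
      exact ih (by omega)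
  have h0 := (hall j hj').1 hj
  have hsub : (Finset.range (n - 2)).image (fun k => (s, k)) ⊆ S := by
    intro c hc
    obtain ⟨k, hk, rfl⟩ := Finset.mem_image.1 hc
    exact (hall k (Finset.mem_range.1 hk)).2 h0
  have := Finset.card_le_card hsub
  rw [Finset.card_image_of_injective _ (fun a b h => by simpa using h), Finset.card_range] at this
  omega

theorem mem_rPar (n : ℕ) (σ : Equiv.Perm (Fin n)) (C : Clause ℕ) (hC : C ∈ rPar n σ) :
    ∃ c ∈ Idx n, C ∈ xorCNF (conr n σ c) := by
  simp only [rPar, ParityCNF, Finset.mem_union, Finset.mem_biUnion, Finset.mem_range] at hC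
  rcases hC with ⟨j, hj, h⟩ | ⟨j, hj, h⟩
  · exact ⟨(true, j), by simpa [Idx, xListA] using hj, h⟩
  · exact ⟨(false, j), by simpa [Idx, xListB] using hj, h⟩

theorem rPar_sound (n : ℕ) (σ : Equiv.Perm (Fin n)) (C : Clause ℕ) (hC : C ∈ rPar n σ) :
    ∃ c ∈ Idx n, ∀ τ, litPar (conr n σ c) τ = false → clauseSat τ C := by
  obtain ⟨c, hc, h⟩ := mem_rPar n σ C hC
  exact ⟨c, hc, fun τ hτ => xorCNF_sound _ τ hτ C h⟩

theorem xorCNF_card (ls : List (Lit ν)) (C : Clause ν) (hC : C ∈ xorCNF ls) :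
    C.card ≤ ls.length ∧ ∀ l ∈ C, l.1 ∈ ls.map Prod.fst := by
  simp only [xorCNF, parityCNF, Finset.mem_image, Finset.mem_filter, Finset.mem_univ,
    true_and] at hC
  obtain ⟨f, hf, rfl⟩ := hC
  constructor
  · exact Finset.card_image_le.trans (by simp)
  · intro l hl
    obtain ⟨i, _, rfl⟩ := Finset.mem_image.1 hl
    refine List.mem_map.2 ⟨ls.get i, List.get_mem _ _, ?_⟩
    split_ifs <;> rfl

theorem rPar_card (n : ℕ) (σ : Equiv.Perm (Fin n)) (C : Clause ℕ) (hC : C ∈ rPar n σ) :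
    C.card ≤ 3 := by
  obtain ⟨⟨s, j⟩, hc, h⟩ := mem_rPar n σ C hC
  refine (xorCNF_card _ C h).1.trans ?_
  cases s <;> simp only [conr, parityCtr] <;> split_ifs <;> simp

theorem rPar_vars (n : ℕ) (hn : 4 ≤ n) (σ : Equiv.Perm (Fin n)) (C : Clause ℕ)
    (hC : C ∈ rPar n σ) : C ⊆ Finset.range (3 * n) ×ˢ Finset.univ := by
  obtain ⟨⟨s, j⟩, hc, h⟩ := mem_rPar n σ C hC
  intro l hl
  have h1 := (xorCNF_card _ C h).2 l hl
  rw [conr_vars n hn] at h1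
  simp only [Finset.mem_product, Finset.mem_univ, and_true, Finset.mem_range]
  have h2 : TT n s ≤ 2 * n := by cases s <;> simp only [TT] <;> omega
  have h3 := pp_lt n hn σ s
  unfold varList at h1
  split_ifs at h1 <;> simp only [List.mem_cons, List.not_mem_nil, or_false] at h1
  · have := h3 0; have := h3 1; omega
  · have := h3 (j + 1); omega
  · have := h3 (n - 2); have := h3 (n - 1); omega

/-! ### Part 4: expansion for good permutations -/

/-- the set with change points `T` -/
def gset (n : ℕ) (T : Finset ℕ) : Finset (Fin n) :=
  Finset.univ.filter (fun i => (T.filter (fun t => t ≤ (i : ℕ))).card % 2 = 1)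

def BadPerm (n r w : ℕ) (σ : Equiv.Perm (Fin n)) : Prop :=
  ∃ T₁ ⊆ Finset.range n, ∃ T₂ ⊆ Finset.range n, ∃ D : Finset (Fin n),
    T₁.card ≤ w + 1 ∧ T₂.card ≤ w + 1 ∧ D.card ≤ w + 1 ∧
    (gset n T₁).map σ.toEmbedding = symmDiff (gset n T₂) D ∧
    r < 2 * (gset n T₁).card + w ∧ (gset n T₁).card ≤ 2 * r + 2

theorem gset_surj (n : ℕ) (u : ℕ → Prop) :
    ∃ T ⊆ Finset.range n, (∀ t ∈ T, t = 0 ∨ (0 < t ∧ ¬ (u (t - 1) ↔ u t))) ∧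
      ∀ i : Fin n, i ∈ gset n T ↔ u i := by
  classical
  let T := (Finset.range n).filter (fun t => (t = 0 ∧ u 0) ∨ (0 < t ∧ ¬ (u (t - 1) ↔ u t)))
  refine ⟨T, Finset.filter_subset _ _, ?_, ?_⟩
  · intro t ht
    rcases (Finset.mem_filter.1 ht).2 with h | h
    · exact Or.inl h.1
    · exact Or.inr h
  · have key : ∀ i, i < n → ((T.filter (fun t => t ≤ i)).card % 2 = 1 ↔ u i) := by
      intro i
      induction i with
      | zero =>
        intro hn
        by_cases h : u 0
        · have : T.filter (fun t => t ≤ 0) = {0} := by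
            ext t
            simp only [T, Finset.mem_filter, Finset.mem_range, Finset.mem_singleton]
            constructor
            · intro h; omega
            · rintro rfl; exact ⟨⟨hn, Or.inl ⟨rfl, h⟩⟩, le_rfl⟩
          rw [this]; simp [h]
        · have : T.filter (fun t => t ≤ 0) = ∅ := by
            ext t
            simp only [T, Finset.mem_filter, Finset.mem_range, Finset.notMem_empty, iff_false]
            rintro ⟨⟨_, h1⟩, h2⟩
            rcases h1 with h1 | h1
            · exact h h1.2
            · omega
          rw [this]; simp [h]
      | succ i ih =>
        intro hn
        have ih := ih (by omega)
        by_cases h : u i ↔ u (i + 1)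
        · have : T.filter (fun t => t ≤ i + 1) = T.filter (fun t => t ≤ i) := by
            apply Finset.filter_congr
            intro t ht
            constructor
            · intro h1
              by_contra h2
              have e : t = i + 1 := by omega
              subst e
              rcases (Finset.mem_filter.1 ht).2 with h3 | h3
              · omega
              · exact h3.2 (by simpa using h)
            · intro h1; omega
          rw [this, ih, h]
        · have : T.filter (fun t => t ≤ i + 1) = insert (i + 1) (T.filter (fun t => t ≤ i)) := by
            ext t
            simp only [Finset.mem_filter, Finset.mem_insert]
            constructor
            · rintro ⟨h1, h2⟩
              by_cases e : t = i + 1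
              · exact Or.inl e
              · exact Or.inr ⟨h1, by omega⟩
            · rintro (rfl | ⟨h1, h2⟩)
              · refine ⟨Finset.mem_filter.2 ⟨Finset.mem_range.2 hn, Or.inr ⟨by omega, ?_⟩⟩, le_rfl⟩
                simpa using h
              · exact ⟨h1, by omega⟩
          rw [this, Finset.card_insert_of_notMem (by simp)]
          have h2 : u (i + 1) ↔ ¬ u i := by tauto
          rw [h2, ← ih]
          omega
    intro i
    rw [← key i i.2]
    simp [gset]

theorem posn_mem_card (n : ℕ) (hn : 4 ≤ n) (S : Finset (Bool × ℕ)) (hS : S ⊆ Idx n) (s : Bool)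
    (U : Finset (Fin n)) (hU : ∀ i : Fin n, i ∈ U ↔ (s, posn n i) ∈ S) :
    (S.filter (fun c => c.1 = s)).card ≤ U.card ∧
      U.card ≤ (S.filter (fun c => c.1 = s)).card + 2 := by
  constructor
  · apply Finset.card_le_card_of_injOn (fun c => if h : c.2 + 1 < n then ⟨c.2 + 1, h⟩ else ⟨0, by omega⟩)
    · rintro ⟨s', j⟩ hc0
      obtain ⟨hc, rfl⟩ := Finset.mem_filter.1 (Finset.mem_coe.1 hc0)
      have hj := hS hc
      simp only [Idx, Finset.mem_product, Finset.mem_univ, true_and, Finset.mem_range] at hj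
      have h1 : j + 1 < n := by omega
      have h2 : posn n (j + 1) = j := by unfold posn; omega
      simp only [h1, dif_pos, Finset.mem_coe, hU, h2]
      exact hc
    · rintro ⟨s', j⟩ hc ⟨s₂, j'⟩ hc' h
      have hc := Finset.mem_filter.1 (Finset.mem_coe.1 hc)
      have hc' := Finset.mem_filter.1 (Finset.mem_coe.1 hc')
      have hj := hS hc.1
      have hj' := hS hc'.1
      simp only [Idx, Finset.mem_product, Finset.mem_univ, true_and, Finset.mem_range] at hj hj'
      have h1 : j + 1 < n := by omega
      have h1' : j' + 1 < n := by omega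
      simp only [h1, h1', dif_pos, Fin.mk.injEq] at h
      have a := hc.2
      have b := hc'.2
      simp only at a b
      rw [a, b]
      congr 1
      omega
  · have hsub : U.image (fun i : Fin n => (i : ℕ)) ⊆
        ((S.filter (fun c => c.1 = s)).image (fun c => c.2 + 1)) ∪ {0, n - 1} := by
      intro y hy
      obtain ⟨i, hi, rfl⟩ := Finset.mem_image.1 hy
      rw [hU] at hi
      by_cases h : (i : ℕ) = 0 ∨ (i : ℕ) = n - 1
      · apply Finset.mem_union_right; simpa using h
      · apply Finset.mem_union_left
        refine Finset.mem_image.2 ⟨_, Finset.mem_filter.2 ⟨hi, rfl⟩, ?_⟩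
        have := i.2
        simp only [posn]
        omega
    have h1 := Finset.card_le_card hsub
    rw [Finset.card_image_of_injective _ Fin.val_injective] at h1
    have h2 := Finset.card_union_le ((S.filter (fun c => c.1 = s)).image (fun c => c.2 + 1))
      {0, n - 1}
    have h3 : ((S.filter (fun c => c.1 = s)).image (fun c => c.2 + 1)).card ≤
      (S.filter (fun c => c.1 = s)).card := Finset.card_image_le
    have h4 : ({0, n - 1} : Finset ℕ).card ≤ 2 := Finset.card_le_two
    omega

theorem changes_card (n : ℕ) (hn : 4 ≤ n) (σ : Equiv.Perm (Fin n)) (S : Finset (Bool × ℕ))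
    (hS : S ⊆ Idx n) (s : Bool) (B : Finset ℕ) (hB : ∀ v, IsBd (conr n σ) S v → v ∈ B) :
    ∃ T ⊆ Finset.range n, T.card ≤ B.card + 1 ∧
      ∀ i : Fin n, i ∈ gset n T ↔ (s, posn n i) ∈ S := by
  obtain ⟨T, hT, h1, h2⟩ := gset_surj n (fun i => (s, posn n i) ∈ S)
  refine ⟨T, hT, ?_, h2⟩
  have h3 : ∀ t ∈ T.erase 0, 2 ≤ t ∧ TT n s + (t - 2) ∈ B := by
    intro t ht
    obtain ⟨ht0, htT⟩ := Finset.mem_erase.1 ht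
    have htn := Finset.mem_range.1 (hT htT)
    rcases h1 t htT with h | ⟨_, h⟩
    · exact absurd h ht0
    · have hb : 2 ≤ t ∧ t < n - 1 := by
        by_contra hcon
        apply h
        have : posn n (t - 1) = posn n t := by unfold posn; omega
        rw [this]
      refine ⟨hb.1, hB _ (bd_path n hn σ S hS s (t - 2) (by omega) ?_)⟩
      have e1 : posn n (t - 1) = t - 2 := by unfold posn; omega
      have e2 : posn n t = t - 2 + 1 := by unfold posn; omega
      rwa [e1, e2] at h
  have h4 : (T.erase 0).card ≤ B.card := by
    apply Finset.card_le_card_of_injOn (fun t => TT n s + (t - 2))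
    · intro t ht; exact (h3 t ht).2
    · intro t ht t' ht' h
      have := (h3 t ht).1
      have := (h3 t' ht').1
      simp only at h
      omega
  have := Finset.pred_card_le_card_erase (s := T) (a := 0)
  omega

theorem expansion (n : ℕ) (hn : 4 ≤ n) (r w : ℕ) (σ : Equiv.Perm (Fin n))
    (hgood : ¬ BadPerm n r w σ) (S : Finset (Bool × ℕ)) (hS : S ⊆ Idx n) (h1 : r < S.card)
    (h2 : S.card ≤ 2 * r) (B : Finset ℕ) (hB : ∀ v, IsBd (conr n σ) S v → v ∈ B) :
    w < B.card := by
  by_contra hw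
  push Not at hw
  apply hgood
  obtain ⟨T₁, hT₁, hc₁, hg₁⟩ := changes_card n hn σ S hS false B hB
  obtain ⟨T₂, hT₂, hc₂, hg₂⟩ := changes_card n hn σ S hS true B hB
  have hD : (symmDiff (gset n T₂) ((gset n T₁).map σ.toEmbedding)).card ≤ B.card := by
    apply Finset.card_le_card_of_injOn (fun i : Fin n => (i : ℕ))
    · intro x hx
      obtain ⟨i, rfl⟩ := σ.surjective x
      apply hB
      apply bd_x n hn σ S hS
      have hx := Finset.mem_coe.1 hx
      have e : σ i ∈ (gset n T₁).map σ.toEmbedding ↔ i ∈ gset n T₁ := by simp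
      rw [Finset.mem_symmDiff, e, hg₁, hg₂] at hx
      tauto
    · exact fun a _ b _ h => Fin.val_injective h
  have p1 := posn_mem_card n hn S hS false _ hg₁
  have p2 := posn_mem_card n hn S hS true _ hg₂
  have hsum : (S.filter (fun c => c.1 = false)).card + (S.filter (fun c => c.1 = true)).card
      = S.card := by
    rw [← Finset.card_filter_add_card_filter_not (s := S) (fun c => c.1 = false)]
    simp
  have hsub : gset n T₂ ⊆ (gset n T₁).map σ.toEmbedding ∪
      symmDiff (gset n T₂) ((gset n T₁).map σ.toEmbedding) := by
    intro x hx
    rw [Finset.mem_union, Finset.mem_symmDiff]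
    tauto
  have h3 := (Finset.card_le_card hsub).trans (Finset.card_union_le _ _)
  rw [Finset.card_map] at h3
  refine ⟨T₁, hT₁, T₂, hT₂, symmDiff (gset n T₂) ((gset n T₁).map σ.toEmbedding),
    by omega, by omega, by omega, ?_, by omega, by omega⟩
  rw [symmDiff_symmDiff_cancel_left]

theorem no_narrow (n : ℕ) (hn : 4 ≤ n) (r w : ℕ) (hr : 1 ≤ r) (hrn : r < n - 2)
    (σ : Equiv.Perm (Fin n)) (hgood : ¬ BadPerm n r w σ) :
    ¬ Der (rPar n σ : Set (Clause ℕ)) (Wd w) ∅ :=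
  width_lb (conr n σ) _ (Idx n) r w hr (fun C hC => rPar_sound n σ C hC)
    (fun S hS h1 h2 B hB => expansion n hn r w σ hgood S hS h1 h2 B hB)
    (fun S hS hne hc => conn n hn σ S hS hne (by omega))

/-! ### Part 5: counting bad permutations -/

theorem card_perm_map (n : ℕ) (W Z : Finset (Fin n)) :
    (Finset.univ.filter (fun σ : Equiv.Perm (Fin n) => W.map σ.toEmbedding = Z)).card *
      n.choose W.card ≤ n.factorial := by
  classical
  by_cases hWZ : Z.card = W.card
  swap
  · have : Finset.univ.filter (fun σ : Equiv.Perm (Fin n) => W.map σ.toEmbedding = Z) = ∅ := by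
      ext σ
      simp only [Finset.mem_filter, Finset.mem_univ, true_and, Finset.notMem_empty, iff_false]
      rintro rfl
      simp at hWZ
    rw [this]; simp
  have hle : W.card ≤ n := by simpa using Finset.card_le_univ W
  have key : (Finset.univ.filter (fun σ : Equiv.Perm (Fin n) => W.map σ.toEmbedding = Z)).card ≤
      W.card.factorial * (n - W.card).factorial := by
    have hmem : ∀ σ : {σ : Equiv.Perm (Fin n) // W.map σ.toEmbedding = Z}, ∀ a,
        a ∈ W ↔ σ.1 a ∈ Z := by
      rintro ⟨σ, rfl⟩ a; simp
    let f : {σ : Equiv.Perm (Fin n) // W.map σ.toEmbedding = Z} →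
        ({a // a ∈ W} ≃ {a // a ∈ Z}) × ({a // a ∉ W} ≃ {a // a ∉ Z}) :=
      fun σ => (σ.1.subtypeEquiv (hmem σ), σ.1.subtypeEquiv (fun a => not_congr (hmem σ a)))
    have hf : Function.Injective f := by
      intro σ τ h
      apply Subtype.ext
      ext a
      congr 1
      by_cases ha : a ∈ W
      · have := congrArg (fun e => ((e.1 ⟨a, ha⟩ : {a // a ∈ Z}) : Fin n)) h
        exact this
      · have := congrArg (fun e => ((e.2 ⟨a, ha⟩ : {a // a ∉ Z}) : Fin n)) h
        exact this
    have h1 := Fintype.card_le_of_injective f hf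
    rw [Fintype.card_subtype, Fintype.card_prod] at h1
    refine h1.trans (le_of_eq ?_)
    have e1 : {a // a ∈ W} ≃ {a // a ∈ Z} := Fintype.equivOfCardEq (by simp [hWZ])
    have e2 : {a // a ∉ W} ≃ {a // a ∉ Z} := Fintype.equivOfCardEq (by
      rw [Fintype.card_subtype_compl, Fintype.card_subtype_compl]; simp [hWZ])
    rw [Fintype.card_equiv e1, Fintype.card_equiv e2, Fintype.card_subtype_compl]
    simp
  calc _ ≤ W.card.factorial * (n - W.card).factorial * n.choose W.card := by gcongr
    _ = n.factorial := by rw [← Nat.choose_mul_factorial_mul_factorial hle]; ring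

theorem two_pow_le_choose (n m : ℕ) (h : 2 * m ≤ n) : 2 ^ m ≤ n.choose m := by
  have h1 : 2 ^ m ≤ (2 * m).choose m := by
    clear h
    rw [← Nat.centralBinom_eq_two_mul_choose]
    induction m with
    | zero => simp
    | succ m ih =>
      have := Nat.succ_mul_centralBinom_succ m
      have h2 : (m + 1) * 2 ^ (m + 1) ≤ (m + 1) * (m + 1).centralBinom := by
        rw [this, pow_succ]
        nlinarith
      exact Nat.le_of_mul_le_mul_left h2 (by omega)
  exact h1.trans (Nat.choose_le_choose m h)

/-- small subsets of a set -/
def ball {α : Type} [DecidableEq α] (A : Finset α) (k : ℕ) : Finset (Finset α) :=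
  A.powerset.filter (fun T => T.card ≤ k)

theorem ball_card {α : Type} [DecidableEq α] (A : Finset α) (k : ℕ) (M : ℝ) (hM : 1 ≤ M) :
    ((ball A k).card : ℝ) ≤ M ^ k * (1 + 1 / M) ^ A.card := by
  have hM0 : (0 : ℝ) < M := by linarith
  have h1 : (1 + 1 / M) ^ A.card = ∑ T ∈ A.powerset, (1 / M) ^ T.card := by
    have := Finset.prod_add (fun _ : α => (1 / M : ℝ)) (fun _ => 1) A
    simp only [Finset.prod_const, one_pow, mul_one] at this
    rw [add_comm, this]
  rw [h1, Finset.mul_sum]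
  calc ((ball A k).card : ℝ) = ∑ T ∈ ball A k, 1 := by simp
    _ ≤ ∑ T ∈ ball A k, M ^ k * (1 / M) ^ T.card := by
      apply Finset.sum_le_sum
      intro T hT
      have hT := (Finset.mem_filter.1 hT).2
      rw [one_div, inv_pow, ← div_eq_mul_inv, le_div_iff₀ (by positivity), one_mul]
      exact pow_le_pow_right₀ hM hT
    _ ≤ _ := by
      apply Finset.sum_le_sum_of_subset_of_nonneg (Finset.filter_subset _ _)
      intros; positivity

open Classical in
theorem bad_card (n r w m : ℕ) (hm : 2 * m + w ≤ r + 1) (hr : 2 * (2 * r + 2) ≤ n) (M : ℝ)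
    (hM : 1 ≤ M) :
    ((Finset.univ.filter (fun σ : Equiv.Perm (Fin n) => BadPerm n r w σ)).card : ℝ) * 2 ^ m ≤
      (M ^ (w + 1) * (1 + 1 / M) ^ n) ^ 3 * n.factorial := by
  let X : Finset (Finset ℕ × Finset ℕ × Finset (Fin n)) :=
    (ball (Finset.range n) (w + 1) ×ˢ (ball (Finset.range n) (w + 1) ×ˢ
      ball (Finset.univ : Finset (Fin n)) (w + 1))).filter (fun x =>
        r < 2 * (gset n x.1).card + w ∧ (gset n x.1).card ≤ 2 * r + 2)
  have hsub : Finset.univ.filter (fun σ : Equiv.Perm (Fin n) => BadPerm n r w σ) ⊆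
      X.biUnion (fun x => Finset.univ.filter (fun σ : Equiv.Perm (Fin n) =>
        (gset n x.1).map σ.toEmbedding = symmDiff (gset n x.2.1) x.2.2)) := by
    intro σ hσ
    obtain ⟨T₁, hT₁, T₂, hT₂, D, h1, h2, h3, h4, h5, h6⟩ := (Finset.mem_filter.1 hσ).2
    rw [Finset.mem_biUnion]
    refine ⟨(T₁, T₂, D), ?_, by simpa using h4⟩
    simp only [X, ball, Finset.mem_filter, Finset.mem_product, Finset.mem_powerset]
    exact ⟨⟨⟨hT₁, h1⟩, ⟨hT₂, h2⟩, Finset.subset_univ _, h3⟩, h5, h6⟩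
  have hX : (X.card : ℝ) ≤ (M ^ (w + 1) * (1 + 1 / M) ^ n) ^ 3 := by
    have h1 : X.card ≤ (ball (Finset.range n) (w + 1)).card * ((ball (Finset.range n) (w + 1)).card *
        (ball (Finset.univ : Finset (Fin n)) (w + 1)).card) := by
      refine (Finset.card_filter_le _ _).trans ?_
      rw [Finset.card_product, Finset.card_product]
    have b1 := ball_card (Finset.range n) (w + 1) M hM
    have b2 := ball_card (Finset.univ : Finset (Fin n)) (w + 1) M hM
    rw [Finset.card_range] at b1
    rw [Finset.card_univ, Fintype.card_fin] at b2
    calc (X.card : ℝ) ≤ ((ball (Finset.range n) (w + 1)).card : ℝ) *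
        ((ball (Finset.range n) (w + 1)).card *
        (ball (Finset.univ : Finset (Fin n)) (w + 1)).card) := by exact_mod_cast h1
      _ ≤ (M ^ (w + 1) * (1 + 1 / M) ^ n) * ((M ^ (w + 1) * (1 + 1 / M) ^ n) *
        (M ^ (w + 1) * (1 + 1 / M) ^ n)) := by gcongr
      _ = _ := by ring
  have hmain : (Finset.univ.filter (fun σ : Equiv.Perm (Fin n) => BadPerm n r w σ)).card * 2 ^ m ≤
      X.card * n.factorial := by
    calc _ ≤ (∑ x ∈ X, (Finset.univ.filter (fun σ : Equiv.Perm (Fin n) =>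
        (gset n x.1).map σ.toEmbedding = symmDiff (gset n x.2.1) x.2.2)).card) * 2 ^ m := by
          gcongr
          exact (Finset.card_le_card hsub).trans Finset.card_biUnion_le
      _ = ∑ x ∈ X, (Finset.univ.filter (fun σ : Equiv.Perm (Fin n) =>
        (gset n x.1).map σ.toEmbedding = symmDiff (gset n x.2.1) x.2.2)).card * 2 ^ m := by
          rw [Finset.sum_mul]
      _ ≤ ∑ x ∈ X, n.factorial := by
          apply Finset.sum_le_sum
          intro x hx
          have hx := (Finset.mem_filter.1 hx).2
          refine le_trans ?_ (card_perm_map n (gset n x.1) (symmDiff (gset n x.2.1) x.2.2))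
          refine Nat.mul_le_mul_left _ ?_
          refine le_trans ?_ (two_pow_le_choose n _ (by omega))
          exact Nat.pow_le_pow_right (by norm_num) (by omega)
      _ = _ := by rw [Finset.sum_const, smul_eq_mul]
  calc _ ≤ (X.card : ℝ) * n.factorial := by exact_mod_cast hmain
    _ ≤ _ := by gcongr

/-! ### Part 6: conclusion -/

theorem good_length (n : ℕ) (hn : 24000 ≤ n) (σ : Equiv.Perm (Fin n))
    (hgood : ¬ BadPerm n (n / 8) (2 * (n / 12000) + 3) σ) (L : List (Clause ℕ))
    (hL : IsResRefutation (rPar n σ) L) :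
    (2 : ℝ) ^ ((1 / (6 * 24000 ^ 2) : ℝ) * n) ≤ (L.length : ℝ) := by
  set q := n / 12000 with hq
  have hnw := no_narrow n (by omega) (n / 8) (2 * q + 3) (by omega) (by omega) σ hgood
  have hnot : ¬ ((L.length : ℝ) * (1 - (q : ℕ) / ((6 * n : ℕ) : ℝ)) ^ q < 1) := by
    intro h
    apply hnw
    have := refutation_width q q (6 * n) 3 (by omega) (by omega) hL
      (Finset.range (3 * n) ×ˢ Finset.univ) (by simp; omega)
      (rPar_vars n (by omega) σ) (rPar_card n σ) h
    have e : q + q + 3 = 2 * q + 3 := by omega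
    rwa [e] at this
  push Not at hnot
  have hn0 : (24000 : ℝ) ≤ n := by exact_mod_cast hn
  have hq1 : (n : ℝ) / 24000 ≤ q := by
    have : n ≤ 24000 * q := by omega
    have : (n : ℝ) ≤ 24000 * q := by exact_mod_cast this
    linarith
  have hq2 : (q : ℝ) ≤ n := by
    have : q ≤ n := by omega
    exact_mod_cast this
  set x : ℝ := (q : ℝ) / ((6 * n : ℕ) : ℝ) with hx
  have hx0 : 0 ≤ 1 - x := by
    rw [hx, sub_nonneg, div_le_one (by push_cast; linarith)]
    push_cast
    linarith
  have h1 : (1 - x) ^ q ≤ Real.exp (-(x * q)) := by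
    calc (1 - x) ^ q ≤ (Real.exp (-x)) ^ q := by
          gcongr
          have := Real.add_one_le_exp (-x)
          linarith
      _ = _ := by rw [← Real.exp_nat_mul]; congr 1; ring
  have h2 : Real.exp (x * q) ≤ L.length := by
    have h3 : 1 ≤ (L.length : ℝ) * Real.exp (-(x * q)) :=
      hnot.trans (mul_le_mul_of_nonneg_left h1 (by positivity))
    rw [Real.exp_neg, ← div_eq_mul_inv, le_div_iff₀ (Real.exp_pos _)] at h3
    linarith
  refine le_trans ?_ h2
  have hxq : (1 / (6 * 24000 ^ 2) : ℝ) * n ≤ x * q := by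
    rw [hx]
    push_cast
    rw [div_mul_eq_mul_div (q : ℝ), le_div_iff₀ (by linarith)]
    have : (n : ℝ) / 24000 * (n / 24000) ≤ q * q := by gcongr
    linarith
  rw [Real.rpow_def_of_pos (by norm_num)]
  apply Real.exp_le_exp.2
  have hlog : Real.log 2 ≤ 1 := by have := Real.log_two_lt_d9; linarith
  refine le_trans ?_ hxq
  have : (0 : ℝ) ≤ (1 / (6 * 24000 ^ 2) : ℝ) * n := by positivity
  nlinarith

open Classical in
theorem bad_small (n : ℕ) (hn : 24000 ≤ n) :
    ((Finset.univ.filter (fun σ : Equiv.Perm (Fin n) =>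
      BadPerm n (n / 8) (2 * (n / 12000) + 3) σ)).card : ℝ) ≤
      Real.exp (85 - n / 100) * n.factorial := by
  have h := bad_card n (n / 8) (2 * (n / 12000) + 3) (n / 20) (by omega) (by omega) 1024
    (by norm_num)
  set w := 2 * (n / 12000) + 3 with hw
  set b : ℝ := ((Finset.univ.filter (fun σ : Equiv.Perm (Fin n) =>
      BadPerm n (n / 8) w σ)).card : ℝ)
  have hl1 := Real.log_two_lt_d9
  have hl2 := Real.log_two_gt_d9
  have hpow : ∀ k : ℕ, (2 : ℝ) ^ k = Real.exp (k * Real.log 2) := by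
    intro k
    rw [Real.exp_nat_mul, Real.exp_log (by norm_num)]
  have h1 : ((1024 : ℝ) ^ (w + 1) * (1 + 1 / 1024) ^ n) ^ 3 ≤
      Real.exp ((30 * (w + 1) : ℕ) * Real.log 2 + 3 * n / 1024) := by
    have a : (1 + 1 / 1024 : ℝ) ^ n ≤ Real.exp (n / 1024) := by
      calc (1 + 1 / 1024 : ℝ) ^ n ≤ (Real.exp (1 / 1024)) ^ n := by
            gcongr
            have := Real.add_one_le_exp (1 / 1024 : ℝ)
            linarith
        _ = _ := by rw [← Real.exp_nat_mul]; congr 1; ring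
    calc ((1024 : ℝ) ^ (w + 1) * (1 + 1 / 1024) ^ n) ^ 3
        ≤ ((1024 : ℝ) ^ (w + 1) * Real.exp (n / 1024)) ^ 3 := by gcongr
      _ = (2 : ℝ) ^ (30 * (w + 1)) * (Real.exp (n / 1024)) ^ 3 := by
          rw [mul_pow, ← pow_mul, show (1024 : ℝ) = 2 ^ 10 by norm_num, ← pow_mul]
          congr 2
          ring
      _ = _ := by
          rw [hpow, ← Real.exp_nat_mul, ← Real.exp_add]
          congr 2
          push_cast
          ring
  have h2 : b * Real.exp ((n / 20 : ℕ) * Real.log 2) ≤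
      Real.exp ((30 * (w + 1) : ℕ) * Real.log 2 + 3 * n / 1024) * n.factorial := by
    rw [← hpow]
    exact h.trans (by gcongr)
  have h3 : b ≤ Real.exp ((30 * (w + 1) : ℕ) * Real.log 2 + 3 * n / 1024
      - (n / 20 : ℕ) * Real.log 2) * n.factorial := by
    rw [Real.exp_sub, div_mul_eq_mul_div, le_div_iff₀ (Real.exp_pos _)]
    exact h2
  refine h3.trans (mul_le_mul_of_nonneg_right (Real.exp_le_exp.2 ?_) (by positivity))
  have hw1 : (w : ℝ) + 1 ≤ n / 6000 + 4 := by
    have : 6000 * (w + 1) ≤ n + 24000 := by omega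
    have : (6000 : ℝ) * (w + 1) ≤ n + 24000 := by exact_mod_cast this
    linarith
  have hm1 : (n : ℝ) / 20 - 1 ≤ (n / 20 : ℕ) := by
    have : n ≤ 20 * (n / 20) + 20 := by omega
    have : (n : ℝ) ≤ 20 * (n / 20 : ℕ) + 20 := by exact_mod_cast this
    linarith
  have hn0 : (24000 : ℝ) ≤ n := by exact_mod_cast hn
  have e1 : ((30 * (w + 1) : ℕ) : ℝ) * Real.log 2 ≤ (30 * (n / 6000 + 4)) * 0.7 := by
    push_cast
    have : 0 ≤ (w : ℝ) + 1 := by positivity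
    gcongr
    linarith
  have e2 : ((n : ℝ) / 20 - 1) * 0.69 ≤ (n / 20 : ℕ) * Real.log 2 := by
    gcongr
    linarith
  linarith

/-- There is a constant `α > 0` such that, when `σ` is chosen uniformly
at random among the permutations of `{1,…,n}`, the probability that every resolution
refutation of `rPar(n, σ)` has length at least `2^(αn)` tends to `1` as `n → ∞`. -/
theorem rPar_resolution_lower_bound_whp :
    ∃ α : ℝ, 0 < α ∧
      Filter.Tendsto
        (fun n : ℕ =>
          (Nat.card {σ : Equiv.Perm (Fin n) //
              ∀ L : List (Clause ℕ), IsResRefutation (rPar n σ) L →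
                (2 : ℝ) ^ (α * n) ≤ (L.length : ℝ)} : ℝ) /
            (Nat.card (Equiv.Perm (Fin n)) : ℝ))
        Filter.atTop (nhds 1) := by
  classical
  refine ⟨1 / (6 * 24000 ^ 2), by norm_num, ?_⟩
  have hlim : Filter.Tendsto (fun n : ℕ => 1 - Real.exp (85 - (n : ℝ) / 100)) Filter.atTop
      (nhds 1) := by
    have h1 : Filter.Tendsto (fun n : ℕ => 85 - (n : ℝ) / 100) Filter.atTop Filter.atBot := by
      have h2 : Filter.Tendsto (fun n : ℕ => (n : ℝ) / 100) Filter.atTop Filter.atTop :=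
        tendsto_natCast_atTop_atTop.atTop_div_const (by norm_num)
      exact (tendsto_const_nhds (x := (85 : ℝ))).add_atBot
        (Filter.tendsto_neg_atTop_atBot.comp h2)
    have h3 := (Real.tendsto_exp_atBot.comp h1).const_sub 1
    simpa using h3
  refine tendsto_of_tendsto_of_tendsto_of_le_of_le' hlim tendsto_const_nhds ?_ ?_
  · filter_upwards [Filter.eventually_ge_atTop 24000] with n hn
    have hcard : Nat.card (Equiv.Perm (Fin n)) = n.factorial := by
      rw [Nat.card_eq_fintype_card, Fintype.card_perm, Fintype.card_fin]
    have hf : (0 : ℝ) < n.factorial := by exact_mod_cast n.factorial_pos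
    rw [hcard, le_div_iff₀ hf, Nat.card_eq_fintype_card, Fintype.card_subtype]
    have hb := bad_small n hn
    have hsum := Finset.card_filter_add_card_filter_not
      (s := (Finset.univ : Finset (Equiv.Perm (Fin n))))
      (fun σ => BadPerm n (n / 8) (2 * (n / 12000) + 3) σ)
    rw [Finset.card_univ, Fintype.card_perm, Fintype.card_fin] at hsum
    have hle : (Finset.univ.filter (fun σ : Equiv.Perm (Fin n) =>
        ¬ BadPerm n (n / 8) (2 * (n / 12000) + 3) σ)).card ≤
        (Finset.univ.filter (fun σ : Equiv.Perm (Fin n) =>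
          ∀ L : List (Clause ℕ), IsResRefutation (rPar n σ) L →
            (2 : ℝ) ^ ((1 / (6 * 24000 ^ 2) : ℝ) * n) ≤ (L.length : ℝ))).card := by
      apply Finset.card_le_card
      intro σ hσ
      rw [Finset.mem_filter] at hσ ⊢
      exact ⟨hσ.1, fun L hL => good_length n hn σ hσ.2 L hL⟩
    have hle' : ((Finset.univ.filter (fun σ : Equiv.Perm (Fin n) =>
        ¬ BadPerm n (n / 8) (2 * (n / 12000) + 3) σ)).card : ℝ) ≤
        ((Finset.univ.filter (fun σ : Equiv.Perm (Fin n) =>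
          ∀ L : List (Clause ℕ), IsResRefutation (rPar n σ) L →
            (2 : ℝ) ^ ((1 / (6 * 24000 ^ 2) : ℝ) * n) ≤ (L.length : ℝ))).card : ℝ) := by
      exact_mod_cast hle
    have hsum' : ((Finset.univ.filter (fun σ : Equiv.Perm (Fin n) =>
        BadPerm n (n / 8) (2 * (n / 12000) + 3) σ)).card : ℝ) +
        ((Finset.univ.filter (fun σ : Equiv.Perm (Fin n) =>
        ¬ BadPerm n (n / 8) (2 * (n / 12000) + 3) σ)).card : ℝ) = n.factorial := by
      exact_mod_cast hsum
    refine le_trans ?_ hle'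
    linarith
  · filter_upwards with n
    apply div_le_one_of_le₀ _ (by positivity)
    exact_mod_cast Nat.card_le_card_of_injective _ Subtype.val_injective
end

section
/- For all A, B ⊆ X = {x_1,…,x_n} with |A| ≥ 4, |B| ≥ 4 and |A△B| ≥ 4, all orderings σ_a of A and σ_b of B, and every ordering σ_c of C, the CNF formula rAddPar(a,b,σ_c) is unsatisfiable; moreover, every variable of rAddPar(a,b,σ_c) occurs in exactly two of its constituent xor constraints (so it is a Tseitin formula). -/
variable {ν : Type} [DecidableEq ν]

/-- The elements of `A` listed in the order induced by the permutation `σ`. -/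
def orderedElems {n : ℕ} (A : Finset (Fin n)) (σ : Equiv.Perm (Fin n)) : List (Fin n) :=
  (List.ofFn (fun i => σ i)).filter (fun i => decide (i ∈ A))

/-- Positive literals for a list of variables, variable `i : Fin n` encoded as `(i : ℕ)`. -/
def posLits {n : ℕ} (l : List (Fin n)) : List (Lit ℕ) := l.map (fun i => ((i : ℕ), true))

/-- The literals of `C`: the symmetric difference `A △ B` in the order induced by `σc`,
all positive except that the literal on the maximal element of `A △ B` is flipped. -/
def symmLits {n : ℕ} (A B : Finset (Fin n)) (σc : Equiv.Perm (Fin n)) : List (Lit ℕ) :=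
  (orderedElems (symmDiff A B) σc).map
    (fun (i : Fin n) => ((i : ℕ), decide ((i : WithBot (Fin n)) ≠ (symmDiff A B).max)))

/-- `rAddPar(a, b, σc) = Parity(A, S, σa) ∧ Parity(B, T, σb) ∧ Parity(C, U, σc)` where
`C` is `A △ B` with one literal flipped; `S`, `T`, `U` are encoded as `n + k`, `2n + k`,
`3n + k` respectively. -/
def rAddPar (n : ℕ) (A B : Finset (Fin n)) (σa σb σc : Equiv.Perm (Fin n)) : CNF ℕ :=
  ParityCNF (posLits (orderedElems A σa)) (fun k => n + k) ∪
    ParityCNF (posLits (orderedElems B σb)) (fun k => 2 * n + k) ∪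
    ParityCNF (symmLits A B σc) (fun k => 3 * n + k)

/-- The constituent xor constraints of `rAddPar(a, b, σc)` (as lists of literals),
indexed by the disjoint sum of the constraint indices of the three parity encodings. -/
def rAddParCtr (n : ℕ) (A B : Finset (Fin n)) (σa σb σc : Equiv.Perm (Fin n)) :
    Fin (A.card - 2) ⊕ Fin (B.card - 2) ⊕ Fin ((symmDiff A B).card - 2) → List (Lit ℕ)
  | Sum.inl j => parityCtr (posLits (orderedElems A σa)) (fun k => n + k) j
  | Sum.inr (Sum.inl j) => parityCtr (posLits (orderedElems B σb)) (fun k => 2 * n + k) j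
  | Sum.inr (Sum.inr j) => parityCtr (symmLits A B σc) (fun k => 3 * n + k) j

/-- The Tseitin graph of `rAddPar(a, b)` (with `σc = id`): vertices are the xor
constraints, two constraints being adjacent whenever they share a variable. -/
def rAddParTseitinGraph (n : ℕ) (A B : Finset (Fin n)) (σa σb : Equiv.Perm (Fin n)) :
    SimpleGraph (Fin (A.card - 2) ⊕ Fin (B.card - 2) ⊕ Fin ((symmDiff A B).card - 2)) :=
  SimpleGraph.fromRel (fun a b =>
    ∃ v : ℕ, v ∈ (rAddParCtr n A B σa σb (Equiv.refl (Fin n)) a).map Prod.fst ∧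
      v ∈ (rAddParCtr n A B σa σb (Equiv.refl (Fin n)) b).map Prod.fst)

def valL (τ : ℕ → Bool) (l : Lit ℕ) : ZMod 2 := if τ l.1 = l.2 then 1 else 0

theorem xor3_sat (τ : ℕ → Bool) (a b c : Lit ℕ) (h : cnfSat τ (xorCNF [a, b, c])) :
    valL τ a + valL τ b + valL τ c = 0 := by
  by_contra hne
  have key : ∀ p q r : Bool, (if p then (1 : ZMod 2) else 0) + (if q then 1 else 0)
      + (if r then 1 else 0) ≠ 0 →
      (Finset.univ.filter (fun i : Fin 3 => (![p, q, r] : Fin 3 → Bool) i = true)).card % 2 = 1 := by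
    decide
  have hk := key (decide (τ a.1 = a.2)) (decide (τ b.1 = b.2)) (decide (τ c.1 = c.2))
    (by simpa [valL] using hne)
  have hmem := h (Finset.univ.image (fun i : Fin 3 =>
      if (![decide (τ a.1 = a.2), decide (τ b.1 = b.2), decide (τ c.1 = c.2)] : Fin 3 → Bool) i
      then negLit ([a, b, c].get i) else [a, b, c].get i)) (by
    unfold xorCNF parityCNF
    refine Finset.mem_image.2 ⟨_, Finset.mem_filter.2 ⟨Finset.mem_univ _, ?_⟩, rfl⟩
    simpa using hk)
  obtain ⟨l, hl, hs⟩ := hmem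
  obtain ⟨i, -, rfl⟩ := Finset.mem_image.1 hl
  fin_cases i
  · by_cases h1 : τ a.1 = a.2 <;> simp [h1, negLit] at hs
  · by_cases h1 : τ b.1 = b.2 <;> simp [h1, negLit] at hs
  · by_cases h1 : τ c.1 = c.2 <;> simp [h1, negLit] at hs

theorem zmod2_eq {a b : ZMod 2} (h : a + b = 0) : a = b := by
  revert a b; decide

theorem valL_pos (τ : ℕ → Bool) (v : ℕ) : valL τ (v, true) = if τ v then 1 else 0 := by
  simp [valL]

theorem parity_sat (τ : ℕ → Bool) (xs : List (Lit ℕ)) (t : ℕ → ℕ) (hm : 4 ≤ xs.length)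
    (h : cnfSat τ (ParityCNF xs t)) : (xs.map (valL τ)).sum = 0 := by
  have hc : ∀ j, j < xs.length - 2 → cnfSat τ (xorCNF (parityCtr xs t j)) := by
    intro j hj C hC
    exact h C (Finset.mem_biUnion.2 ⟨j, Finset.mem_range.2 hj, hC⟩)
  set g : ℕ → ZMod 2 := fun i => valL τ (xs.getD i (t 0, true)) with hg
  have hsum : (xs.map (valL τ)).sum = ∑ i ∈ Finset.range xs.length, g i := by
    rw [Finset.sum_range, ← Fin.sum_univ_fun_getElem]
    refine Finset.sum_congr rfl fun i _ => ?_
    simp [hg]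
  have hpre : ∀ k, k < xs.length - 3 →
      ∑ i ∈ Finset.range (k + 2), g i = valL τ (t k, true) := by
    intro k
    induction k with
    | zero =>
      intro _
      have := hc 0 (by omega)
      rw [parityCtr, if_pos rfl] at this
      have := xor3_sat _ _ _ _ this
      rw [Finset.sum_range_succ, Finset.sum_range_one]
      exact zmod2_eq this
    | succ k ih =>
      intro hk
      have := hc (k + 1) (by omega)
      rw [parityCtr, if_neg (by omega), if_pos hk] at this
      have := xor3_sat _ _ _ _ this
      rw [Finset.sum_range_succ, ih (by omega)]
      exact zmod2_eq this
  have := hc (xs.length - 3) (by omega)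
  rw [parityCtr, if_neg (by omega), if_neg (by omega)] at this
  have := xor3_sat _ _ _ _ this
  obtain ⟨m, hm'⟩ : ∃ m, xs.length = m + 4 := ⟨xs.length - 4, by omega⟩
  rw [hsum, hm', Finset.sum_range_succ, Finset.sum_range_succ, hpre m (by omega)]
  simpa [hg, hm'] using this

theorem posLits_eq {n : ℕ} (l : List (Fin n)) :
    posLits l = l.map (fun i : Fin n => (i.val, true)) := by
  induction l with
  | nil => rfl
  | cons a l ih =>
    rw [List.map_cons, ← ih]
    rfl

theorem orderedElems_nodup {n : ℕ} (A : Finset (Fin n)) (σ : Equiv.Perm (Fin n)) :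
    (orderedElems A σ).Nodup :=
  (List.nodup_ofFn.2 σ.injective).filter _

theorem mem_orderedElems {n : ℕ} (A : Finset (Fin n)) (σ : Equiv.Perm (Fin n)) (i : Fin n) :
    i ∈ orderedElems A σ ↔ i ∈ A := by
  simp only [orderedElems, List.mem_filter, List.mem_ofFn, decide_eq_true_eq, and_iff_right_iff_imp]
  exact fun _ => ⟨σ.symm i, by simp⟩

theorem orderedElems_toFinset {n : ℕ} (A : Finset (Fin n)) (σ : Equiv.Perm (Fin n)) :
    (orderedElems A σ).toFinset = A := by
  ext i; simp [mem_orderedElems]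

theorem orderedElems_length {n : ℕ} (A : Finset (Fin n)) (σ : Equiv.Perm (Fin n)) :
    (orderedElems A σ).length = A.card := by
  rw [← List.toFinset_card_of_nodup (orderedElems_nodup A σ), orderedElems_toFinset]

theorem orderedElems_sum {n : ℕ} (A : Finset (Fin n)) (σ : Equiv.Perm (Fin n))
    (f : Fin n → ZMod 2) : ((orderedElems A σ).map f).sum = ∑ i ∈ A, f i := by
  rw [← List.sum_toFinset f (orderedElems_nodup A σ), orderedElems_toFinset]

theorem sum_symmDiff {n : ℕ} (A B : Finset (Fin n)) (f : Fin n → ZMod 2) :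
    ∑ i ∈ symmDiff A B, f i = ∑ i ∈ A, f i + ∑ i ∈ B, f i := by
  have h : ∀ S : Finset (Fin n), ∑ i ∈ S, f i = ∑ i, if i ∈ S then f i else 0 := by
    intro S; simp
  rw [h, h A, h B, ← Finset.sum_add_distrib]
  refine Finset.sum_congr rfl fun i _ => ?_
  have h2 : f i + f i = 0 := CharTwo.add_self_eq_zero _
  by_cases ha : i ∈ A <;> by_cases hb : i ∈ B <;> simp [Finset.mem_symmDiff, ha, hb, h2]

theorem unsat_part (n : ℕ) (A B : Finset (Fin n))
    (hA : 4 ≤ A.card) (hB : 4 ≤ B.card) (hAB : 4 ≤ (symmDiff A B).card)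
    (σa σb σc : Equiv.Perm (Fin n)) : Unsat (rAddPar n A B σa σb σc) := by
  rintro ⟨τ, h⟩
  have ha := parity_sat τ (posLits (orderedElems A σa)) (fun k => n + k)
    (by simpa [posLits_eq, orderedElems_length] using hA)
    (fun C hC => h C (Finset.mem_union_left _ (Finset.mem_union_left _ hC)))
  have hb := parity_sat τ (posLits (orderedElems B σb)) (fun k => 2 * n + k)
    (by simpa [posLits_eq, orderedElems_length] using hB)
    (fun C hC => h C (Finset.mem_union_left _ (Finset.mem_union_right _ hC)))
  have hc := parity_sat τ (symmLits A B σc) (fun k => 3 * n + k)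
    (by simpa [symmLits, orderedElems_length] using hAB)
    (fun C hC => h C (Finset.mem_union_right _ hC))
  obtain ⟨M, hM⟩ := Finset.max_of_nonempty (Finset.card_pos.1 (by omega : 0 < (symmDiff A B).card))
  have hMm := Finset.mem_of_max hM
  rw [posLits_eq, List.map_map, orderedElems_sum] at ha hb
  rw [symmLits, List.map_map, orderedElems_sum] at hc
  have e : ∀ i ∈ symmDiff A B, (valL τ ∘ fun (i : Fin n) =>
      ((i : ℕ), decide ((i : WithBot (Fin n)) ≠ (symmDiff A B).max))) i
      = (valL τ ∘ fun (i : Fin n) => ((i : ℕ), true)) i + if i = M then 1 else 0 := by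
    intro i _
    by_cases hi : i = M
    · subst hi
      cases h1 : τ i <;> simp [valL, hM, h1] <;> decide
    · have : (i : WithBot (Fin n)) ≠ (M : WithBot (Fin n)) := by simpa using hi
      simp [valL, hM, hi]
  rw [Finset.sum_congr rfl e, Finset.sum_add_distrib, sum_symmDiff, ha, hb,
    Finset.sum_ite_eq' , if_pos hMm] at hc
  exact absurd hc (by decide)

theorem mem_parityCtr (xs : List (Lit ℕ)) (t : ℕ → ℕ) (hm : 4 ≤ xs.length) (v j : ℕ)
    (hj : j < xs.length - 2) :
    v ∈ (parityCtr xs t j).map Prod.fst ↔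
      (∃ k, k < xs.length - 3 ∧ v = t k ∧ (j = k ∨ j = k + 1)) ∨
      (∃ i, ∃ hi : i < xs.length, v = xs[i].1 ∧ j = min (i - 1) (xs.length - 3)) := by
  have hg : ∀ i (hi : i < xs.length), xs.getD i (t 0, true) = xs[i] := by
    intro i hi; simp [hi]
  unfold parityCtr
  split_ifs with h0 h1
  · rw [hg 0 (by omega), hg 1 (by omega)]
    simp only [List.map_cons, List.map_nil, List.mem_cons, List.not_mem_nil, or_false]
    constructor
    · rintro (h | h | h)
      · exact Or.inr ⟨0, by omega, h, by omega⟩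
      · exact Or.inr ⟨1, by omega, h, by omega⟩
      · exact Or.inl ⟨0, by omega, h, by omega⟩
    · rintro (⟨k, hk, h, h'⟩ | ⟨i, hi, h, h'⟩)
      · obtain rfl : k = 0 := by omega
        exact Or.inr (Or.inr h)
      · obtain rfl | rfl : i = 0 ∨ i = 1 := by omega
        · exact Or.inl h
        · exact Or.inr (Or.inl h)
  · rw [hg (j + 1) (by omega)]
    simp only [List.map_cons, List.map_nil, List.mem_cons, List.not_mem_nil, or_false]
    constructor
    · rintro (h | h | h)
      · exact Or.inl ⟨j - 1, by omega, h, by omega⟩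
      · exact Or.inr ⟨j + 1, by omega, h, by omega⟩
      · exact Or.inl ⟨j, by omega, h, by omega⟩
    · rintro (⟨k, hk, h, h'⟩ | ⟨i, hi, h, h'⟩)
      · obtain rfl | rfl := h'
        · exact Or.inr (Or.inr h)
        · exact Or.inl h
      · obtain rfl : i = j + 1 := by omega
        exact Or.inr (Or.inl h)
  · rw [hg (xs.length - 2) (by omega), hg (xs.length - 1) (by omega)]
    simp only [List.map_cons, List.map_nil, List.mem_cons, List.not_mem_nil, or_false]
    constructor
    · rintro (h | h | h)
      · exact Or.inl ⟨_, by omega, h, by omega⟩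
      · exact Or.inr ⟨_, by omega, h, by omega⟩
      · exact Or.inr ⟨_, by omega, h, by omega⟩
    · rintro (⟨k, hk, h, h'⟩ | ⟨i, hi, h, h'⟩)
      · obtain rfl : k = xs.length - 4 := by omega
        exact Or.inl h
      · obtain rfl | rfl : i = xs.length - 2 ∨ i = xs.length - 1 := by omega
        · exact Or.inr (Or.inl h)
        · exact Or.inr (Or.inr h)

def cntCtr (xs : List (Lit ℕ)) (t : ℕ → ℕ) (m v : ℕ) : ℕ :=
  (Finset.univ.filter (fun j : Fin (m - 2) => v ∈ (parityCtr xs t j).map Prod.fst)).card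

/-- Number of constraints of one parity encoding, with Tseitin block starting at `s`,
in which a variable occurs. -/
theorem cntCtr_eq (xs : List (Lit ℕ)) (s n m v : ℕ) (hs : n ≤ s) (hxm : xs.length = m)
    (hm : 4 ≤ m) (hnd : (xs.map Prod.fst).Nodup) (hlt : ∀ x ∈ xs.map Prod.fst, x < n) :
    cntCtr xs (fun k => s + k) m v =
      (if v ∈ xs.map Prod.fst then 1 else 0) + (if s ≤ v ∧ v < s + (m - 3) then 2 else 0) := by
  subst hxm
  unfold cntCtr
  have hmem := fun j : Fin (xs.length - 2) => mem_parityCtr xs (fun k => s + k) hm v j j.2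
  simp_rw [hmem]
  by_cases hv : v ∈ xs.map Prod.fst
  · have hvn := hlt v hv
    rw [if_pos hv, if_neg (by omega)]
    obtain ⟨i, hi, rfl⟩ := List.getElem_of_mem hv
    have hi' : i < xs.length := by simpa using hi
    rw [add_zero, Finset.card_eq_one]
    refine ⟨⟨min (i - 1) (xs.length - 3), by omega⟩, ?_⟩
    ext j
    simp only [Finset.mem_filter, Finset.mem_univ, true_and, Finset.mem_singleton, Fin.ext_iff]
    constructor
    · rintro (⟨k, hk, h, h'⟩ | ⟨i', hi', h, h'⟩)
      · omega
      · have : i = i' := by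
          have h2 : (xs.map Prod.fst)[i] = (xs.map Prod.fst)[i']'(by simpa using hi') := by
            rw [h]; simp
          exact (hnd.getElem_inj_iff).1 h2
        rw [h', this]
    · intro h
      exact Or.inr ⟨i, hi', by simp, h⟩
  · rw [if_neg hv, zero_add]
    have hno : ∀ i (hi : i < xs.length), v ≠ xs[i].1 := by
      rintro i hi rfl
      exact hv (List.mem_map_of_mem (List.getElem_mem hi))
    split_ifs with hr
    · rw [Finset.card_eq_two]
      refine ⟨⟨v - s, by omega⟩, ⟨v - s + 1, by omega⟩, by simp [Fin.ext_iff], ?_⟩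
      ext j
      simp only [Finset.mem_filter, Finset.mem_univ, true_and, Finset.mem_singleton, Fin.ext_iff,
        Finset.mem_insert]
      constructor
      · rintro (⟨k, hk, h, h'⟩ | ⟨i', hi', h, h'⟩)
        · omega
        · exact absurd h (hno _ _)
      · intro h
        exact Or.inl ⟨v - s, by omega, by omega, h⟩
    · rw [Finset.card_eq_zero, Finset.filter_eq_empty_iff]
      rintro j - (⟨k, hk, h, h'⟩ | ⟨i', hi', h, h'⟩)
      · omega
      · exact absurd h (hno _ _)

theorem cnfVars_parity (xs : List (Lit ℕ)) (t : ℕ → ℕ) (C : Clause ℕ)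
    (hC : C ∈ ParityCNF xs t) (v : ℕ) (b : Bool) (hb : (v, b) ∈ C) :
    0 < cntCtr xs t xs.length v := by
  obtain ⟨j, hj, hC⟩ := Finset.mem_biUnion.1 hC
  obtain ⟨f, -, rfl⟩ := Finset.mem_image.1 hC
  obtain ⟨i, -, hi⟩ := Finset.mem_image.1 hb
  refine Finset.card_pos.2 ⟨⟨j, Finset.mem_range.1 hj⟩, ?_⟩
  simp only [Finset.mem_filter, Finset.mem_univ, true_and]
  have : v = ((parityCtr xs t j).get i).1 := by
    have := congrArg Prod.fst hi
    split_ifs at this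
    · exact this.symm
    · exact this.symm
  rw [this]
  exact List.mem_map_of_mem (List.get_mem _ _)

theorem cnt_split (n : ℕ) (A B : Finset (Fin n)) (σa σb σc : Equiv.Perm (Fin n)) (v : ℕ) :
    (Finset.univ.filter
          (fun c : Fin (A.card - 2) ⊕ Fin (B.card - 2) ⊕ Fin ((symmDiff A B).card - 2) =>
            v ∈ (rAddParCtr n A B σa σb σc c).map Prod.fst)).card =
      cntCtr (posLits (orderedElems A σa)) (fun k => n + k) A.card v +
      (cntCtr (posLits (orderedElems B σb)) (fun k => 2 * n + k) B.card v +
      cntCtr (symmLits A B σc) (fun k => 3 * n + k) (symmDiff A B).card v) := by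
  unfold cntCtr
  rw [Finset.card_filter, Fintype.sum_sum_type, Fintype.sum_sum_type]
  simp only [Finset.card_filter, rAddParCtr]
  first | rfl | congr!

theorem posLits_fst {n : ℕ} (A : Finset (Fin n)) (σ : Equiv.Perm (Fin n)) :
    (posLits (orderedElems A σ)).map Prod.fst = (orderedElems A σ).map Fin.val := by
  simp [posLits_eq]

theorem symmLits_fst {n : ℕ} (A B : Finset (Fin n)) (σ : Equiv.Perm (Fin n)) :
    (symmLits A B σ).map Prod.fst = (orderedElems (symmDiff A B) σ).map Fin.val := by
  simp [symmLits]

theorem cnt_ordered {n : ℕ} (A : Finset (Fin n)) (σ : Equiv.Perm (Fin n)) (xs : List (Lit ℕ))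
    (hxs : xs.map Prod.fst = (orderedElems A σ).map Fin.val) (hA : 4 ≤ A.card)
    (s v : ℕ) (hs : n ≤ s) :
    xs.length = A.card ∧ cntCtr xs (fun k => s + k) A.card v =
      (if ∃ i ∈ A, (i : ℕ) = v then 1 else 0) + (if s ≤ v ∧ v < s + (A.card - 3) then 2 else 0) := by
  have hl : xs.length = A.card := by
    have := congrArg List.length hxs
    simpa [orderedElems_length] using this
  refine ⟨hl, ?_⟩
  rw [cntCtr_eq xs s n A.card v hs hl hA]
  · simp only [hxs, List.mem_map, mem_orderedElems]
  · rw [hxs]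
    exact (orderedElems_nodup A σ).map Fin.val_injective
  · rw [hxs]
    intro x hx
    obtain ⟨i, -, rfl⟩ := List.mem_map.1 hx
    exact i.2

/-- For all `A, B ⊆ {x_1,…,x_n}` with `|A| ≥ 4`, `|B| ≥ 4`,
`|A △ B| ≥ 4`, all orderings `σa` of `A`, `σb` of `B` and `σc` of `C`, the formula
`rAddPar(a, b, σc)` is unsatisfiable, and every variable occurs in exactly two of its
constituent xor constraints (so it is a Tseitin formula). -/
theorem rAddPar_unsat_and_tseitin (n : ℕ) (A B : Finset (Fin n))
    (hA : 4 ≤ A.card) (hB : 4 ≤ B.card) (hAB : 4 ≤ (symmDiff A B).card)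
    (σa σb σc : Equiv.Perm (Fin n)) :
    Unsat (rAddPar n A B σa σb σc) ∧
      ∀ v ∈ cnfVars (rAddPar n A B σa σb σc),
        (Finset.univ.filter
          (fun c : Fin (A.card - 2) ⊕ Fin (B.card - 2) ⊕ Fin ((symmDiff A B).card - 2) =>
            v ∈ (rAddParCtr n A B σa σb σc c).map Prod.fst)).card = 2 := by
  refine ⟨unsat_part n A B hA hB hAB σa σb σc, ?_⟩
  rintro v ⟨C, hC, b, hb⟩
  rw [cnt_split]
  obtain ⟨la, ca⟩ := cnt_ordered A σa _ (posLits_fst A σa) hA n v le_rfl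
  obtain ⟨lb, cb⟩ := cnt_ordered B σb _ (posLits_fst B σb) hB (2 * n) v (by omega)
  obtain ⟨lc, cc⟩ := cnt_ordered (symmDiff A B) σc _ (symmLits_fst A B σc) hAB (3 * n) v (by omega)
  have hpos : 0 < cntCtr (posLits (orderedElems A σa)) (fun k => n + k) A.card v ∨
      0 < cntCtr (posLits (orderedElems B σb)) (fun k => 2 * n + k) B.card v ∨
      0 < cntCtr (symmLits A B σc) (fun k => 3 * n + k) (symmDiff A B).card v := by
    rcases Finset.mem_union.1 hC with hC | hC
    · rcases Finset.mem_union.1 hC with hC | hC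
      · left; rw [← la]; exact cnfVars_parity _ _ C hC v b hb
      · right; left; rw [← lb]; exact cnfVars_parity _ _ C hC v b hb
    · right; right; rw [← lc]; exact cnfVars_parity _ _ C hC v b hb
  rw [ca, cb, cc] at hpos ⊢
  have cardA : A.card ≤ n := by simpa using A.card_le_univ
  have cardB : B.card ≤ n := by simpa using B.card_le_univ
  have cardC : (symmDiff A B).card ≤ n := by simpa using (symmDiff A B).card_le_univ
  by_cases hv : v < n
  · have e : ∀ S : Finset (Fin n), (∃ i ∈ S, (i : ℕ) = v) ↔ (⟨v, hv⟩ : Fin n) ∈ S := by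
      intro S
      constructor
      · rintro ⟨i, hi, rfl⟩; exact hi
      · exact fun h => ⟨_, h, rfl⟩
    have eC := e (symmDiff A B)
    rw [Finset.mem_symmDiff] at eC
    simp only [e A, e B, eC] at hpos ⊢
    have r1 : ¬ (n ≤ v ∧ v < n + (A.card - 3)) := by omega
    have r2 : ¬ (2 * n ≤ v ∧ v < 2 * n + (B.card - 3)) := by omega
    have r3 : ¬ (3 * n ≤ v ∧ v < 3 * n + ((symmDiff A B).card - 3)) := by omega
    rw [if_neg r1, if_neg r2, if_neg r3] at hpos ⊢
    by_cases ha : (⟨v, hv⟩ : Fin n) ∈ A <;> by_cases hb : (⟨v, hv⟩ : Fin n) ∈ B <;>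
      simp [ha, hb] at hpos ⊢
  · have e : ∀ S : Finset (Fin n), ¬ ∃ i ∈ S, (i : ℕ) = v := by
      rintro S ⟨i, -, rfl⟩; exact hv i.2
    simp only [e, if_false, zero_add] at hpos ⊢
    split_ifs at hpos ⊢ <;> omega
end

section
/- For every n ≥ 6 and every permutation σ of {1,…,n}, the Tseitin graph of rPar(n,σ) — the graph whose vertices are the xor constraints of rPar(n,σ), with two constraints adjacent whenever they share a variable — is isomorphic to the graph obtained from G_σ by contracting the four edges (1,2), (n−1,n), (σ(1)′,σ(2)′) and (σ(n−1)′,σ(n)′) (merging parallel edges). In particular, the treewidth of the Tseitin graph of rPar(n,σ) is at least tw(G_σ) − 4. -/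
variable {ν : Type} [DecidableEq ν]

/-- The constituent xor constraints of `rPar(n, σ)` (as lists of literals), indexed by
`Fin (n-2) ⊕ Fin (n-2)`: constraint `Sum.inl j` is the `j`-th constraint of
`Parity(X, S, id)` and `Sum.inr j` the `j`-th constraint of `Parity(X', T, σ)`. -/
def rParCtr (n : ℕ) (σ : Equiv.Perm (Fin n)) : Fin (n - 2) ⊕ Fin (n - 2) → List (Lit ℕ)
  | Sum.inl j => parityCtr (xListA n) (fun k => n + k) j
  | Sum.inr j => parityCtr (xListB n σ) (fun k => 2 * n + k) j

/-- The Tseitin graph of `rPar(n, σ)`: vertices are the xor constraints, two constraints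
being adjacent whenever they share a variable. -/
def rParTseitinGraph (n : ℕ) (σ : Equiv.Perm (Fin n)) :
    SimpleGraph (Fin (n - 2) ⊕ Fin (n - 2)) :=
  SimpleGraph.fromRel (fun a b =>
    ∃ v : ℕ, v ∈ (rParCtr n σ a).map Prod.fst ∧ v ∈ (rParCtr n σ b).map Prod.fst)

/-- `(T, bag)` is a tree decomposition of the graph `G`. -/
def IsTreeDecomp {V ι : Type} (G : SimpleGraph V) (T : SimpleGraph ι)
    (bag : ι → Finset V) : Prop :=
  T.IsTree ∧ (∀ v : V, ∃ i, v ∈ bag i) ∧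
    (∀ u v : V, G.Adj u v → ∃ i, u ∈ bag i ∧ v ∈ bag i) ∧
    (∀ v : V, (T.induce {i | v ∈ bag i}).Connected)

/-- The treewidth of a finite simple graph: the least `w` such that `G` has a tree
decomposition all of whose bags have at most `w + 1` vertices. -/
noncomputable def treewidth {V : Type} [Fintype V] [DecidableEq V] (G : SimpleGraph V) : ℕ :=
  sInf {w | ∃ (ι : Type) (T : SimpleGraph ι) (bag : ι → Finset V),
    IsTreeDecomp G T bag ∧ ∀ i, (bag i).card ≤ w + 1}

/-- The graph obtained from `G` by contracting the edge `uv`, merging `v` into `u`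
(and merging parallel edges); the vertex `v` becomes isolated. -/
def contract {V : Type} [DecidableEq V] (G : SimpleGraph V) (u v : V) : SimpleGraph V :=
  SimpleGraph.fromRel (fun a b =>
    ∃ a' b', G.Adj a' b' ∧ (if a' = v then u else a') = a ∧ (if b' = v then u else b') = b)

/-- The graph `G_σ` on vertices `{1,…,n} ∪ {1',…,n'}` (`Sum.inl i` is the vertex `i+1`,
`Sum.inr i` the vertex `(i+1)'`), with the path `1 - 2 - ⋯ - n`, the path
`σ(1)' - σ(2)' - ⋯ - σ(n)'` and the perfect matching `(i, i')`. -/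
def Gsig (n : ℕ) (σ : Equiv.Perm (Fin n)) : SimpleGraph (Fin n ⊕ Fin n) :=
  SimpleGraph.fromRel (fun a b =>
    match a, b with
    | Sum.inl i, Sum.inl j => (j : ℕ) = (i : ℕ) + 1
    | Sum.inr i, Sum.inr j => ((σ.symm j : Fin n) : ℕ) = ((σ.symm i : Fin n) : ℕ) + 1
    | Sum.inl i, Sum.inr j => i = j
    | _, _ => False)

/-- The graph `G*_σ` on `{1,…,n}` obtained from `G_σ` by contracting every matching edge
`(i, i')` and merging parallel edges. -/
def GsigStar (n : ℕ) (σ : Equiv.Perm (Fin n)) : SimpleGraph (Fin n) :=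
  SimpleGraph.fromRel (fun i j =>
    (j : ℕ) = (i : ℕ) + 1 ∨ ((σ.symm j : Fin n) : ℕ) = ((σ.symm i : Fin n) : ℕ) + 1)

/-- Image of a graph under a vertex map (loops removed). -/
def mapG {V : Type} (G : SimpleGraph V) (f : V → V) : SimpleGraph V :=
  SimpleGraph.fromRel (fun a b => ∃ a' b', G.Adj a' b' ∧ f a' = a ∧ f b' = b)

theorem mapG_adj {V : Type} (G : SimpleGraph V) (f : V → V) (a b : V) :
    (mapG G f).Adj a b ↔ a ≠ b ∧ ∃ a' b', G.Adj a' b' ∧ f a' = a ∧ f b' = b := by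
  unfold mapG
  rw [SimpleGraph.fromRel_adj]
  constructor
  · rintro ⟨h, h1 | ⟨x, y, hxy, hx, hy⟩⟩
    · exact ⟨h, h1⟩
    · exact ⟨h, y, x, hxy.symm, hy, hx⟩
  · rintro ⟨h, h1⟩
    exact ⟨h, Or.inl h1⟩

theorem contract_eq {V : Type} [DecidableEq V] (G : SimpleGraph V) (u v : V) :
    contract G u v = mapG G (fun a => if a = v then u else a) := rfl

theorem mapG_mapG {V : Type} (G : SimpleGraph V) (f g : V → V) :
    mapG (mapG G f) g = mapG G (g ∘ f) := by
  ext a b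
  simp only [mapG_adj]
  constructor
  · rintro ⟨h, x, y, ⟨_, x', y', hxy, rfl, rfl⟩, rfl, rfl⟩
    exact ⟨h, x', y', hxy, rfl, rfl⟩
  · rintro ⟨h, x', y', hxy, rfl, rfl⟩
    exact ⟨h, f x', f y', ⟨fun e => h (by simp [e]), x', y', hxy, rfl, rfl⟩, rfl, rfl⟩

/-- The position to which position `i` is contracted. -/
def clampN (n i : ℕ) : ℕ := if i = 0 then 1 else if i = n - 1 then n - 2 else i

theorem clampN_lt (n i : ℕ) (hn : 5 < n) (hi : i < n) : clampN n i < n := by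
  unfold clampN; split_ifs <;> omega

theorem clampN_mid (n i : ℕ) (h1 : 1 ≤ i) (h2 : i < n - 1) : clampN n i = i := by
  unfold clampN; split_ifs <;> omega

theorem mem_parityCtr_s6 (n : ℕ) (hn : 5 < n) (f : Fin n → ℕ) (b : Fin n → Bool) (t : ℕ → ℕ)
    (j : ℕ) (hj : j < n - 2) (v : ℕ) :
    v ∈ (parityCtr (List.ofFn (fun i : Fin n => (f i, b i))) t j).map Prod.fst ↔
      (∃ i : Fin n, clampN n i = j + 1 ∧ v = f i) ∨
      (∃ k, k ≤ n - 4 ∧ (k = j ∨ k + 1 = j) ∧ v = t k) := by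
  have hget : ∀ i (hi : i < n) d,
      (List.ofFn (fun i : Fin n => (f i, b i))).getD i d = (f ⟨i, hi⟩, b ⟨i, hi⟩) := by
    intro i hi d
    simp [List.getD_eq_getElem?_getD, hi]
  unfold parityCtr
  rw [List.length_ofFn]
  split_ifs with h0 h1
  · subst h0
    rw [hget 0 (by omega), hget 1 (by omega)]
    simp only [List.map_cons, List.map_nil, List.mem_cons, List.not_mem_nil, or_false]
    constructor
    · rintro (h | h | h)
      · exact Or.inl ⟨⟨0, by omega⟩, by simp [clampN], h⟩
      · refine Or.inl ⟨⟨1, by omega⟩, ?_, h⟩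
        simp only [clampN]; split_ifs <;> omega
      · exact Or.inr ⟨0, by omega, Or.inl rfl, h⟩
    · rintro (⟨⟨i, hi⟩, hc, h⟩ | ⟨k, hk, hk', h⟩)
      · have : i = 0 ∨ i = 1 := by
          simp only [clampN] at hc; split_ifs at hc <;> omega
        rcases this with rfl | rfl
        · exact Or.inl h
        · exact Or.inr (Or.inl h)
      · obtain rfl : k = 0 := by omega
        exact Or.inr (Or.inr h)
  · rw [hget (j + 1) (by omega)]
    simp only [List.map_cons, List.map_nil, List.mem_cons, List.not_mem_nil, or_false]
    constructor
    · rintro (h | h | h)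
      · exact Or.inr ⟨j - 1, by omega, by omega, h⟩
      · exact Or.inl ⟨⟨j + 1, by omega⟩, clampN_mid n (j + 1) (by omega) (by omega), h⟩
      · exact Or.inr ⟨j, by omega, Or.inl rfl, h⟩
    · rintro (⟨⟨i, hi⟩, hc, h⟩ | ⟨k, hk, rfl | hk', h⟩)
      · obtain rfl : i = j + 1 := by
          simp only [clampN] at hc; split_ifs at hc <;> omega
        exact Or.inr (Or.inl h)
      · exact Or.inr (Or.inr h)
      · obtain rfl : k = j - 1 := by omega
        exact Or.inl h
  · rw [hget (n - 2) (by omega), hget (n - 1) (by omega)]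
    simp only [List.map_cons, List.map_nil, List.mem_cons, List.not_mem_nil, or_false]
    constructor
    · rintro (h | h | h)
      · exact Or.inr ⟨n - 4, by omega, by omega, h⟩
      · refine Or.inl ⟨⟨n - 2, by omega⟩, ?_, h⟩
        simp only [clampN]; split_ifs <;> omega
      · refine Or.inl ⟨⟨n - 1, by omega⟩, ?_, h⟩
        simp only [clampN]; split_ifs <;> omega
    · rintro (⟨⟨i, hi⟩, hc, h⟩ | ⟨k, hk, hk', h⟩)
      · have : i = n - 2 ∨ i = n - 1 := by
          simp only [clampN] at hc; split_ifs at hc <;> omega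
        rcases this with rfl | rfl
        · exact Or.inr (Or.inl h)
        · exact Or.inr (Or.inr h)
      · obtain rfl : k = n - 4 := by omega
        exact Or.inl h

theorem mem_ctr_inl (n : ℕ) (hn : 5 < n) (σ : Equiv.Perm (Fin n)) (j : Fin (n - 2)) (v : ℕ) :
    v ∈ (rParCtr n σ (Sum.inl j)).map Prod.fst ↔
      (∃ i : Fin n, clampN n i = j + 1 ∧ v = i) ∨
      (∃ k : ℕ, k ≤ n - 4 ∧ (k = j ∨ k + 1 = j) ∧ v = n + k) :=
  mem_parityCtr_s6 n hn (fun i => (i : ℕ)) (fun _ => true) (fun k => n + k) j j.2 v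

theorem mem_ctr_inr (n : ℕ) (hn : 5 < n) (σ : Equiv.Perm (Fin n)) (j : Fin (n - 2)) (v : ℕ) :
    v ∈ (rParCtr n σ (Sum.inr j)).map Prod.fst ↔
      (∃ i : Fin n, clampN n i = j + 1 ∧ v = σ i) ∨
      (∃ k : ℕ, k ≤ n - 4 ∧ (k = j ∨ k + 1 = j) ∧ v = 2 * n + k) :=
  mem_parityCtr_s6 n hn (fun i => (σ i : ℕ)) (fun i => decide ((σ i : ℕ) ≠ n - 1))
    (fun k => 2 * n + k) j j.2 v

theorem ts_adj_iff (n : ℕ) (σ : Equiv.Perm (Fin n)) (a b) :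
    (rParTseitinGraph n σ).Adj a b ↔ a ≠ b ∧
      ∃ v : ℕ, v ∈ (rParCtr n σ a).map Prod.fst ∧ v ∈ (rParCtr n σ b).map Prod.fst := by
  unfold rParTseitinGraph
  rw [SimpleGraph.fromRel_adj]
  constructor
  · rintro ⟨h, h1 | ⟨v, h1, h2⟩⟩
    · exact ⟨h, h1⟩
    · exact ⟨h, v, h2, h1⟩
  · rintro ⟨h, h1⟩
    exact ⟨h, Or.inl h1⟩

theorem ts_ll (n : ℕ) (hn : 5 < n) (σ : Equiv.Perm (Fin n)) (i j : Fin (n - 2)) :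
    (rParTseitinGraph n σ).Adj (Sum.inl i) (Sum.inl j) ↔
      (j : ℕ) = i + 1 ∨ (i : ℕ) = j + 1 := by
  rw [ts_adj_iff]
  simp only [mem_ctr_inl n hn]
  have hi := i.2
  have hj := j.2
  constructor
  · rintro ⟨h, v, h1, h2⟩
    have hne : (i : ℕ) ≠ j := fun e => h (by rw [Fin.ext e])
    rcases h1 with ⟨p, hp, rfl⟩ | ⟨k, hk, hk', rfl⟩ <;>
      rcases h2 with ⟨q, hq, e⟩ | ⟨l, hl, hl', e⟩
    · rw [← e] at hq; omega
    · omega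
    · omega
    · omega
  · intro h
    refine ⟨fun e => ?_, n + min (i : ℕ) j, Or.inr ⟨min (i : ℕ) j, by omega, by omega, rfl⟩,
      Or.inr ⟨min (i : ℕ) j, by omega, by omega, rfl⟩⟩
    obtain rfl := Sum.inl_injective e
    omega

theorem ts_rr (n : ℕ) (hn : 5 < n) (σ : Equiv.Perm (Fin n)) (i j : Fin (n - 2)) :
    (rParTseitinGraph n σ).Adj (Sum.inr i) (Sum.inr j) ↔
      (j : ℕ) = i + 1 ∨ (i : ℕ) = j + 1 := by
  rw [ts_adj_iff]
  simp only [mem_ctr_inr n hn]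
  have hi := i.2
  have hj := j.2
  constructor
  · rintro ⟨h, v, h1, h2⟩
    have hne : (i : ℕ) ≠ j := fun e => h (by rw [Fin.ext e])
    rcases h1 with ⟨p, hp, rfl⟩ | ⟨k, hk, hk', rfl⟩ <;>
      rcases h2 with ⟨q, hq, e⟩ | ⟨l, hl, hl', e⟩
    · obtain rfl := σ.injective (Fin.ext e); omega
    · have := (σ p).2; omega
    · have := (σ q).2; omega
    · omega
  · intro h
    refine ⟨fun e => ?_, 2 * n + min (i : ℕ) j,
      Or.inr ⟨min (i : ℕ) j, by omega, by omega, rfl⟩,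
      Or.inr ⟨min (i : ℕ) j, by omega, by omega, rfl⟩⟩
    obtain rfl := Sum.inr_injective e
    omega

theorem ts_lr (n : ℕ) (hn : 5 < n) (σ : Equiv.Perm (Fin n)) (i j : Fin (n - 2)) :
    (rParTseitinGraph n σ).Adj (Sum.inl i) (Sum.inr j) ↔
      ∃ p : Fin n, clampN n (σ p) = i + 1 ∧ clampN n p = j + 1 := by
  rw [ts_adj_iff]
  simp only [mem_ctr_inr n hn, mem_ctr_inl n hn]
  constructor
  · rintro ⟨h, v, h1, h2⟩
    rcases h1 with ⟨p, hp, rfl⟩ | ⟨k, hk, hk', rfl⟩ <;>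
      rcases h2 with ⟨q, hq, e⟩ | ⟨l, hl, hl', e⟩
    · exact ⟨q, by rw [← e]; exact hp, hq⟩
    · have := p.2; omega
    · have := (σ q).2; omega
    · omega
  · rintro ⟨p, h1, h2⟩
    exact ⟨by simp, σ p, Or.inl ⟨σ p, h1, rfl⟩, Or.inl ⟨p, h2, rfl⟩⟩

theorem gs_ll (n : ℕ) (σ : Equiv.Perm (Fin n)) (i j : Fin n) :
    (Gsig n σ).Adj (Sum.inl i) (Sum.inl j) ↔ (j : ℕ) = i + 1 ∨ (i : ℕ) = j + 1 := by
  simp only [Gsig, SimpleGraph.fromRel_adj, ne_eq, Sum.inl.injEq, Fin.ext_iff]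
  omega

theorem gs_rr (n : ℕ) (σ : Equiv.Perm (Fin n)) (i j : Fin n) :
    (Gsig n σ).Adj (Sum.inr (σ i)) (Sum.inr (σ j)) ↔ (j : ℕ) = i + 1 ∨ (i : ℕ) = j + 1 := by
  simp only [Gsig, SimpleGraph.fromRel_adj, ne_eq, Sum.inr.injEq, Equiv.symm_apply_apply,
    EmbeddingLike.apply_eq_iff_eq, Fin.ext_iff]
  omega

theorem gs_lr (n : ℕ) (σ : Equiv.Perm (Fin n)) (i j : Fin n) :
    (Gsig n σ).Adj (Sum.inl i) (Sum.inr j) ↔ i = j := by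
  simp [Gsig, SimpleGraph.fromRel_adj]

/-- The total contraction map. -/
def phi (n : ℕ) (hn : 5 < n) (σ : Equiv.Perm (Fin n)) : Fin n ⊕ Fin n → Fin n ⊕ Fin n
  | Sum.inl i => Sum.inl ⟨clampN n i, clampN_lt n i hn i.2⟩
  | Sum.inr i => Sum.inr (σ ⟨clampN n (σ.symm i), clampN_lt n _ hn (σ.symm i).2⟩)

theorem contract4 (n : ℕ) (hn : 5 < n) (σ : Equiv.Perm (Fin n)) :
    contract
            (contract
              (contract
                (contract (Gsig n σ) (Sum.inl ⟨1, by omega⟩) (Sum.inl ⟨0, by omega⟩))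
                (Sum.inl ⟨n - 2, by omega⟩) (Sum.inl ⟨n - 1, by omega⟩))
              (Sum.inr (σ ⟨1, by omega⟩)) (Sum.inr (σ ⟨0, by omega⟩)))
            (Sum.inr (σ ⟨n - 2, by omega⟩)) (Sum.inr (σ ⟨n - 1, by omega⟩))
      = mapG (Gsig n σ) (phi n hn σ) := by
  simp only [contract_eq, mapG_mapG]
  congr 1
  funext w
  rcases w with i | i
  · obtain ⟨i, hi⟩ := i
    by_cases h0 : i = 0
    · subst h0
      have h1 : ¬ (1 = n - 1) := by omega
      simp [phi, clampN, h1]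
    · by_cases h1 : i = n - 1
      · subst h1
        simp [phi, clampN, h0]
      · simp [phi, clampN, h0, h1]
  · obtain ⟨i, rfl⟩ := σ.surjective i
    obtain ⟨i, hi⟩ := i
    by_cases h0 : i = 0
    · subst h0
      have h1 : ¬ (1 = n - 1) := by omega
      simp [phi, clampN, h1]
    · by_cases h1 : i = n - 1
      · subst h1
        simp [phi, clampN, h0]
      · simp [phi, clampN, h0, h1]

/-- The vertex map of the isomorphism. -/
def vmap (n : ℕ) (σ : Equiv.Perm (Fin n)) : Fin (n - 2) ⊕ Fin (n - 2) → Fin n ⊕ Fin n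
  | Sum.inl j => Sum.inl ⟨j + 1, by omega⟩
  | Sum.inr j => Sum.inr (σ ⟨j + 1, by omega⟩)

theorem vmap_inj (n : ℕ) (σ : Equiv.Perm (Fin n)) : Function.Injective (vmap n σ) := by
  rintro (i | i) (j | j) h <;>
    simp [vmap, Fin.ext_iff] at h ⊢ <;> omega

theorem phi_fix (n : ℕ) (hn : 5 < n) (σ : Equiv.Perm (Fin n)) (a) :
    phi n hn σ (vmap n σ a) = vmap n σ a := by
  rcases a with i | i <;> have := i.2 <;>
    simp [vmap, phi, clampN_mid n (i + 1) (by omega) (by omega)]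

theorem vmap_ll (n : ℕ) (hn : 5 < n) (σ : Equiv.Perm (Fin n)) (i j : Fin (n - 2)) :
    (mapG (Gsig n σ) (phi n hn σ)).Adj (vmap n σ (Sum.inl i)) (vmap n σ (Sum.inl j)) ↔
      (j : ℕ) = i + 1 ∨ (i : ℕ) = j + 1 := by
  have hi := i.2
  have hj := j.2
  rw [mapG_adj]
  constructor
  · rintro ⟨h, a | a, b | b, hab, ha, hb⟩ <;> simp [phi, vmap] at ha hb
    rw [gs_ll] at hab
    have hne : (i : ℕ) ≠ j := fun e => h (by rw [Fin.ext e])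
    simp only [clampN] at ha hb
    have := a.2
    have := b.2
    split_ifs at ha hb <;> omega
  · intro h
    refine ⟨fun e => ?_, vmap n σ (Sum.inl i), vmap n σ (Sum.inl j), ?_, ?_, ?_⟩
    · have := Sum.inl_injective (vmap_inj n σ e)
      subst this; omega
    · simp only [vmap, gs_ll]; omega
    · exact phi_fix n hn σ _
    · exact phi_fix n hn σ _

theorem vmap_rr (n : ℕ) (hn : 5 < n) (σ : Equiv.Perm (Fin n)) (i j : Fin (n - 2)) :
    (mapG (Gsig n σ) (phi n hn σ)).Adj (vmap n σ (Sum.inr i)) (vmap n σ (Sum.inr j)) ↔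
      (j : ℕ) = i + 1 ∨ (i : ℕ) = j + 1 := by
  have hi := i.2
  have hj := j.2
  rw [mapG_adj]
  constructor
  · rintro ⟨h, a | a, b | b, hab, ha, hb⟩ <;> simp [phi, vmap] at ha hb
    obtain ⟨a, rfl⟩ := σ.surjective a
    obtain ⟨b, rfl⟩ := σ.surjective b
    rw [gs_rr] at hab
    have hne : (i : ℕ) ≠ j := fun e => h (by rw [Fin.ext e])
    simp only [clampN, Equiv.symm_apply_apply] at ha hb
    have := a.2
    have := b.2
    split_ifs at ha hb <;> omega
  · intro h
    refine ⟨fun e => ?_, vmap n σ (Sum.inr i), vmap n σ (Sum.inr j), ?_, ?_, ?_⟩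
    · have := Sum.inr_injective (vmap_inj n σ e)
      subst this; omega
    · simp only [vmap, gs_rr]; omega
    · exact phi_fix n hn σ _
    · exact phi_fix n hn σ _

theorem vmap_lr (n : ℕ) (hn : 5 < n) (σ : Equiv.Perm (Fin n)) (i j : Fin (n - 2)) :
    (mapG (Gsig n σ) (phi n hn σ)).Adj (vmap n σ (Sum.inl i)) (vmap n σ (Sum.inr j)) ↔
      ∃ p : Fin n, clampN n (σ p) = i + 1 ∧ clampN n p = j + 1 := by
  rw [mapG_adj]
  constructor
  · rintro ⟨h, a | a, b | b, hab, ha, hb⟩ <;> simp [phi, vmap] at ha hb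
    obtain ⟨b, rfl⟩ := σ.surjective b
    rw [gs_lr] at hab
    subst hab
    exact ⟨b, ha, by simpa using hb⟩
  · rintro ⟨p, h1, h2⟩
    refine ⟨by simp [vmap], Sum.inl (σ p), Sum.inr (σ p), by rw [gs_lr], ?_, ?_⟩
    · simp [phi, vmap, h1]
    · simp [phi, vmap, h2]

theorem vmap_adj (n : ℕ) (hn : 5 < n) (σ : Equiv.Perm (Fin n)) (a b) :
    (mapG (Gsig n σ) (phi n hn σ)).Adj (vmap n σ a) (vmap n σ b) ↔
      (rParTseitinGraph n σ).Adj a b := by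
  rcases a with i | i <;> rcases b with j | j
  · rw [vmap_ll, ts_ll n hn]
  · rw [vmap_lr, ts_lr n hn]
  · rw [SimpleGraph.adj_comm, vmap_lr, SimpleGraph.adj_comm, ts_lr n hn]
  · rw [vmap_rr, ts_rr n hn]

/-- The set of removed vertices. -/
def remSet (n : ℕ) (hn : 5 < n) (σ : Equiv.Perm (Fin n)) : Finset (Fin n ⊕ Fin n) :=
  {Sum.inl ⟨0, by omega⟩, Sum.inl ⟨n - 1, by omega⟩,
    Sum.inr (σ ⟨0, by omega⟩), Sum.inr (σ ⟨n - 1, by omega⟩)}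

theorem vmap_not_mem (n : ℕ) (hn : 5 < n) (σ : Equiv.Perm (Fin n)) (a) :
    vmap n σ a ∉ remSet n hn σ := by
  rcases a with i | i <;> have := i.2 <;> simp [vmap, remSet] <;> omega

theorem vmap_surj (n : ℕ) (hn : 5 < n) (σ : Equiv.Perm (Fin n)) (w)
    (hw : w ∉ remSet n hn σ) : ∃ a, vmap n σ a = w := by
  rcases w with i | i
  · have := i.2
    simp [remSet, Fin.ext_iff] at hw
    refine ⟨Sum.inl ⟨i - 1, by omega⟩, ?_⟩
    simp only [vmap, Sum.inl.injEq, Fin.ext_iff]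
    omega
  · obtain ⟨i, rfl⟩ := σ.surjective i
    have := i.2
    simp [remSet, Fin.ext_iff (a := i)] at hw
    refine ⟨Sum.inr ⟨i - 1, by omega⟩, ?_⟩
    simp only [vmap, Sum.inr.injEq, EmbeddingLike.apply_eq_iff_eq, Fin.ext_iff (b := i)]
    omega

theorem tw_bound (n : ℕ) (hn : 5 < n) (σ : Equiv.Perm (Fin n)) :
    treewidth (Gsig n σ) ≤ treewidth (rParTseitinGraph n σ) + 4 := by
  have hne : {w | ∃ (ι : Type) (T : SimpleGraph ι) (bag : ι → Finset (Fin (n - 2) ⊕ Fin (n - 2))),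
      IsTreeDecomp (rParTseitinGraph n σ) T bag ∧ ∀ i, (bag i).card ≤ w + 1}.Nonempty := by
    refine ⟨(Finset.univ : Finset (Fin (n - 2) ⊕ Fin (n - 2))).card, Unit, ⊥,
      fun _ => Finset.univ, ⟨?_, ?_, ?_, ?_⟩, fun _ => Nat.le_succ _⟩
    · exact SimpleGraph.IsTree.of_subsingleton
    · intro v; exact ⟨(), Finset.mem_univ _⟩
    · intro u v _; exact ⟨(), Finset.mem_univ _, Finset.mem_univ _⟩
    · intro v
      have : Nonempty {i : Unit | v ∈ (Finset.univ : Finset (Fin (n - 2) ⊕ Fin (n - 2)))} :=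
        ⟨⟨(), by simp⟩⟩
      exact SimpleGraph.IsTree.of_subsingleton.1
  obtain ⟨ι, T, bag, ⟨hT, hv, he, hc⟩, hw⟩ := Nat.sInf_mem hne
  refine Nat.sInf_le ⟨ι, T, fun i => (bag i).image (vmap n σ) ∪ remSet n hn σ,
    ⟨hT, ?_, ?_, ?_⟩, ?_⟩
  · intro w
    by_cases h : w ∈ remSet n hn σ
    · obtain ⟨i⟩ := hT.1.nonempty
      exact ⟨i, Finset.mem_union_right _ h⟩
    · obtain ⟨a, rfl⟩ := vmap_surj n hn σ w h
      obtain ⟨i, hi⟩ := hv a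
      exact ⟨i, Finset.mem_union_left _ (Finset.mem_image_of_mem _ hi)⟩
  · have key : ∀ w, ∃ i, w ∈ (bag i).image (vmap n σ) ∪ remSet n hn σ := by
      intro w
      by_cases h : w ∈ remSet n hn σ
      · obtain ⟨i⟩ := hT.1.nonempty
        exact ⟨i, Finset.mem_union_right _ h⟩
      · obtain ⟨a, rfl⟩ := vmap_surj n hn σ w h
        obtain ⟨i, hi⟩ := hv a
        exact ⟨i, Finset.mem_union_left _ (Finset.mem_image_of_mem _ hi)⟩
    intro u v huv
    by_cases hu : u ∈ remSet n hn σ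
    · obtain ⟨i, hi⟩ := key v
      exact ⟨i, Finset.mem_union_right _ hu, hi⟩
    by_cases hv' : v ∈ remSet n hn σ
    · obtain ⟨i, hi⟩ := key u
      exact ⟨i, hi, Finset.mem_union_right _ hv'⟩
    obtain ⟨a, rfl⟩ := vmap_surj n hn σ u hu
    obtain ⟨b, rfl⟩ := vmap_surj n hn σ v hv'
    have hab : (rParTseitinGraph n σ).Adj a b := by
      rw [← vmap_adj n hn, mapG_adj]
      exact ⟨huv.ne, _, _, huv, phi_fix n hn σ a, phi_fix n hn σ b⟩
    obtain ⟨i, hi, hj⟩ := he a b hab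
    exact ⟨i, Finset.mem_union_left _ (Finset.mem_image_of_mem _ hi),
      Finset.mem_union_left _ (Finset.mem_image_of_mem _ hj)⟩
  · intro w
    by_cases h : w ∈ remSet n hn σ
    · have : {i | w ∈ (bag i).image (vmap n σ) ∪ remSet n hn σ} = Set.univ := by
        ext i; simp [h]
      rw [this]
      exact (SimpleGraph.induceUnivIso T).connected_iff.2 hT.1
    · obtain ⟨a, rfl⟩ := vmap_surj n hn σ w h
      have : {i | vmap n σ a ∈ (bag i).image (vmap n σ) ∪ remSet n hn σ} = {i | a ∈ bag i} := by
        ext i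
        simp only [Set.mem_ofPred_eq, Finset.mem_union, h, or_false]
        exact Function.Injective.mem_finset_image (vmap_inj n σ)
      rw [this]
      exact hc a
  · intro i
    have h1 := Finset.card_union_le ((bag i).image (vmap n σ)) (remSet n hn σ)
    have h2 : ((bag i).image (vmap n σ)).card ≤ (bag i).card := Finset.card_image_le
    have h3 : (remSet n hn σ).card ≤ 4 := Finset.card_le_four
    have h4 := hw i
    unfold treewidth
    beta_reduce
    omega

/-- For every `n ≥ 6` and permutation `σ`, the Tseitin graph of
`rPar(n, σ)` is isomorphic to the graph obtained from `G_σ` by contracting the four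
edges `(1,2)`, `(n-1,n)`, `(σ(1)', σ(2)')`, `(σ(n-1)', σ(n)')` (merging parallel edges,
i.e. restricting to the vertices remaining after the merges); in particular its
treewidth is at least `tw(G_σ) - 4`. -/
theorem rParTseitinGraph_iso_contraction (n : ℕ) (hn : 6 ≤ n) (σ : Equiv.Perm (Fin n)) :
    Nonempty
      ((rParTseitinGraph n σ) ≃g
        ((contract
            (contract
              (contract
                (contract (Gsig n σ) (Sum.inl ⟨1, by omega⟩) (Sum.inl ⟨0, by omega⟩))
                (Sum.inl ⟨n - 2, by omega⟩) (Sum.inl ⟨n - 1, by omega⟩))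
              (Sum.inr (σ ⟨1, by omega⟩)) (Sum.inr (σ ⟨0, by omega⟩)))
            (Sum.inr (σ ⟨n - 2, by omega⟩)) (Sum.inr (σ ⟨n - 1, by omega⟩))).induce
          {w : Fin n ⊕ Fin n |
            w ≠ Sum.inl ⟨0, by omega⟩ ∧ w ≠ Sum.inl ⟨n - 1, by omega⟩ ∧
            w ≠ Sum.inr (σ ⟨0, by omega⟩) ∧ w ≠ Sum.inr (σ ⟨n - 1, by omega⟩)})) ∧
    treewidth (Gsig n σ) - 4 ≤ treewidth (rParTseitinGraph n σ) := by
  refine ⟨?_, by have := tw_bound n hn σ; omega⟩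
  rw [contract4 n hn σ]
  refine ⟨⟨Equiv.ofBijective (fun a => ⟨vmap n σ a, ?_⟩) ⟨?_, ?_⟩, ?_⟩⟩
  · have := vmap_not_mem n hn σ a
    simpa [remSet] using this
  · intro a b hab
    exact vmap_inj n σ (congrArg Subtype.val hab)
  · rintro ⟨w, hw⟩
    obtain ⟨a, ha⟩ := vmap_surj n hn σ w (by simpa [remSet] using hw)
    exact ⟨a, Subtype.ext ha⟩
  · intro a b
    exact vmap_adj n hn σ a b
end
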